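/- arXiv:1111.5588 — 2 statements merged into one kernel-verified Lean document; each statement's English description precedes it below -/
import Mathlib

section
/- For all real numbers γ* > 0 and d_* > 0 there exists a constant C_2 > 0 such that for every convex polygon Ω of diameter 1 satisfying G1 (γ < γ*) and G2 (|v_i − v_j| > d_* for all i ≠ j), for every x in the interior of Ω, and for all indices i ≠ j and a ≠ b: ‖∇t_i(x)‖ · t_j(x) / (r_a(x) · r_b(x)) ≤ C_2 · (Σ_{k=1}^n w_k(x))², where ∇t_i(x) denotes the gradient at x of the function y ↦ tan(α_i(y)/2). -/
open EuclideanGeometry Metric Real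

noncomputable section

abbrev E2 := EuclideanSpace ℝ (Fin 2)

structure ConvexPolygon (n : ℕ) [NeZero n] where
  v : Fin n → E2
  hn : 3 ≤ n
  extreme : ∀ i, v i ∈ Set.extremePoints ℝ (convexHull ℝ (Set.range v))
  boundary : frontier (convexHull ℝ (Set.range v)) = ⋃ i, segment ℝ (v i) (v (i + 1))

namespace ConvexPolygon

variable {n : ℕ} [NeZero n] (P : ConvexPolygon n)

def region : Set E2 := convexHull ℝ (Set.range P.v)

def edge (i : Fin n) : Set E2 := segment ℝ (P.v i) (P.v (i + 1))

def inradius : ℝ := sSup {r : ℝ | ∃ c : E2, Metric.closedBall c r ⊆ P.region}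

def G1 (γs : ℝ) : Prop := Metric.diam P.region / P.inradius < γs

def G2 (ds : ℝ) : Prop := ∀ i j : Fin n, i ≠ j → ds < dist (P.v i) (P.v j)

def interiorAngle (i : Fin n) : ℝ := ∠ (P.v (i - 1)) (P.v i) (P.v (i + 1))

def angleAt (i : Fin n) (x : E2) : ℝ := ∠ (P.v i) x (P.v (i + 1))

def r (i : Fin n) (x : E2) : ℝ := dist x (P.v i)

def t (i : Fin n) (x : E2) : ℝ := Real.tan (P.angleAt i x / 2)

def w (i : Fin n) (x : E2) : ℝ := (P.t (i - 1) x + P.t i x) / P.r i x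

def lambda (i : Fin n) (x : E2) : ℝ := P.w i x / ∑ j, P.w j x

def nonadjacent (i j : Fin n) : Prop := i ≠ j ∧ i ≠ j + 1 ∧ j ≠ i + 1

def SepProp (h : ℝ) : Prop :=
  ∀ x ∈ P.region,
    (∀ i j k : Fin n, i ≠ j → j ≠ k → i ≠ k →
      ¬((Metric.closedBall x h ∩ P.edge i).Nonempty ∧
        (Metric.closedBall x h ∩ P.edge j).Nonempty ∧
        (Metric.closedBall x h ∩ P.edge k).Nonempty)) ∧
    (∀ i j : Fin n, nonadjacent i j →
      ¬((Metric.closedBall x h ∩ P.edge i).Nonempty ∧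
        (Metric.closedBall x h ∩ P.edge j).Nonempty))

end ConvexPolygon

section Analytic

/-- The angle between two vectors is controlled by their distance. -/
lemma angle_le_three_mul (a b : E2) (ha : a ≠ 0) (hb : ‖a‖ / 2 ≤ ‖b‖) :
    InnerProductGeometry.angle a b ≤ 3 * (‖a - b‖ / ‖a‖) := by
  have hapos : 0 < ‖a‖ := norm_pos_iff.mpr ha
  have h0 := InnerProductGeometry.angle_nonneg a b
  have hpi := InnerProductGeometry.angle_le_pi a b
  have h1 := Real.cos_le_one_sub_mul_cos_sq (x := InnerProductGeometry.angle a b)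
    (by rw [abs_of_nonneg h0]; exact hpi)
  have h2 := InnerProductGeometry.cos_angle_mul_norm_mul_norm a b
  have h3 : ‖a - b‖ ^ 2 = ‖a‖ ^ 2 - 2 * inner ℝ a b + ‖b‖ ^ 2 := norm_sub_sq_real a b
  set θ := InnerProductGeometry.angle a b
  have hpi2 : Real.pi ^ 2 ≤ 16 := by nlinarith [Real.pi_pos, Real.pi_le_four]
  have h4 : (1 / 8) * θ ^ 2 ≤ 2 / Real.pi ^ 2 * θ ^ 2 := by
    apply mul_le_mul_of_nonneg_right _ (sq_nonneg _)
    rw [div_le_div_iff₀ (by norm_num) (by positivity)]; linarith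
  have h5 : (1 / 8) * θ ^ 2 ≤ 1 - Real.cos θ := by linarith
  have h6 : (1 / 8) * θ ^ 2 * (‖a‖ * ‖b‖) ≤ ‖a - b‖ ^ 2 / 2 := by
    have := mul_le_mul_of_nonneg_right h5 (by positivity : 0 ≤ ‖a‖ * ‖b‖)
    nlinarith [sq_nonneg (‖a‖ - ‖b‖)]
  have h7 : (1 / 8) * θ ^ 2 * (‖a‖ * (‖a‖ / 2)) ≤ ‖a - b‖ ^ 2 / 2 := by
    refine le_trans ?_ h6
    gcongr
  rw [← mul_div_assoc, le_div_iff₀ hapos]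
  apply le_of_sq_le_sq _ (by positivity)
  nlinarith [sq_nonneg ‖a - b‖]

lemma angle_abs_sub (p q x y : E2) (hp : p ≠ x) (hq : q ≠ x)
    (h1 : dist y x ≤ dist x p / 2) (h2 : dist y x ≤ dist x q / 2) :
    |∠ p y q - ∠ p x q| ≤ 3 * (dist y x * (1 / dist x p + 1 / dist x q)) := by
  have key : ∀ z : E2, z ≠ x → dist y x ≤ dist x z / 2 →
      InnerProductGeometry.angle (z - x) (z - y) ≤ 3 * (dist y x * (1 / dist x z)) := by
    intro z hz h
    have e1 : ‖z - x‖ = dist x z := by rw [dist_comm, dist_eq_norm]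
    have e2 : ‖z - y‖ = dist y z := by rw [dist_comm, dist_eq_norm]
    have e3 : ‖(z - x) - (z - y)‖ = dist y x := by rw [dist_eq_norm]; congr 1; abel
    have := angle_le_three_mul (z - x) (z - y) (sub_ne_zero.mpr hz) (by
      rw [e1, e2]; have := dist_triangle x y z; rw [dist_comm x y] at this; linarith)
    rw [e1, e3] at this
    rwa [mul_one_div]
  have kp := key p hp h1
  have kq := key q hq h2
  have t1 := InnerProductGeometry.angle_le_angle_add_angle (p - y) (p - x) (q - y)
  have t2 := InnerProductGeometry.angle_le_angle_add_angle (p - x) (q - x) (q - y)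
  have t3 := InnerProductGeometry.angle_le_angle_add_angle (p - x) (p - y) (q - x)
  have t4 := InnerProductGeometry.angle_le_angle_add_angle (p - y) (q - y) (q - x)
  have c1 := InnerProductGeometry.angle_comm (p - y) (p - x)
  have c2 := InnerProductGeometry.angle_comm (q - y) (q - x)
  have d1 : ∠ p y q = InnerProductGeometry.angle (p - y) (q - y) := rfl
  have d2 : ∠ p x q = InnerProductGeometry.angle (p - x) (q - x) := rfl
  rw [d1, d2, abs_le]
  constructor <;> linarith

lemma one_add_tan_sq_mul (θ : ℝ) (h0 : 0 ≤ θ) (h : θ < Real.pi) :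
    (1 + Real.tan (θ / 2) ^ 2) * (1 + Real.cos θ) = 2 := by
  have hc : 0 < Real.cos (θ / 2) := Real.cos_pos_of_mem_Ioo ⟨by linarith [Real.pi_pos], by linarith⟩
  have h1 : Real.cos θ = 2 * Real.cos (θ / 2) ^ 2 - 1 := by
    rw [← Real.cos_two_mul]; congr 1; ring
  have h2 := Real.inv_one_add_tan_sq hc.ne'
  rw [h1, ← h2]
  have : 1 + Real.tan (θ / 2) ^ 2 ≠ 0 := by positivity
  field_simp
  ring

lemma gradient_bound (p q x : E2) (hp : p ≠ x) (hq : q ≠ x) (hpi : ∠ p x q < Real.pi)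
    (hp1 : dist x p ≤ 1) (hq1 : dist x q ≤ 1) :
    ‖gradient (fun y : E2 => Real.tan (∠ p y q / 2)) x‖ ≤
      6 * (1 + Real.tan (∠ p x q / 2) ^ 2) / (dist x p * dist x q) := by
  have hp0 : 0 < dist x p := dist_pos.mpr hp.symm
  have hq0 : 0 < dist x q := dist_pos.mpr hq.symm
  have h0 : 0 ≤ ∠ p x q := InnerProductGeometry.angle_nonneg _ _
  have hc : 0 < Real.cos (∠ p x q / 2) :=
    Real.cos_pos_of_mem_Ioo ⟨by linarith [Real.pi_pos], by linarith⟩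
  unfold gradient
  rw [LinearIsometryEquiv.norm_map]
  apply norm_fderiv_le_of_lip' ℝ (by positivity)
  have hd := Real.hasDerivAt_tan hc.ne'
  have hs : 1 / Real.cos (∠ p x q / 2) ^ 2 = 1 + Real.tan (∠ p x q / 2) ^ 2 := by
    rw [← Real.inv_one_add_tan_sq hc.ne']; simp
  rw [hs] at hd
  set D := 1 + Real.tan (∠ p x q / 2) ^ 2 with hD
  have hDpos : 0 < D := by positivity
  have hlo := (hasDerivAt_iff_isLittleO.mp hd).def hDpos
  have hcont : ContinuousAt (fun y : E2 => ∠ p y q / 2) x := by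
    have h := EuclideanGeometry.continuousAt_angle (x := (p, x, q)) hp hq
    have h2 : ContinuousAt (fun y : E2 => (p, y, q)) x := by fun_prop
    exact (ContinuousAt.comp (f := fun y : E2 => (p, y, q)) h h2).div_const 2
  have hev := hcont.eventually hlo
  have hb1 : ∀ᶠ y in nhds x, dist y x < dist x p / 2 := Metric.ball_mem_nhds x (by positivity)
  have hb2 : ∀ᶠ y in nhds x, dist y x < dist x q / 2 := Metric.ball_mem_nhds x (by positivity)
  filter_upwards [hev, hb1, hb2] with y hy h1 h2
  have hA := angle_abs_sub p q x y hp hq h1.le h2.le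
  simp only [smul_eq_mul, Real.norm_eq_abs] at hy ⊢
  have hB : |Real.tan (∠ p y q / 2) - Real.tan (∠ p x q / 2)| ≤
      2 * D * |∠ p y q / 2 - ∠ p x q / 2| := by
    have := abs_add_le (Real.tan (∠ p y q / 2) - Real.tan (∠ p x q / 2)
      - (∠ p y q / 2 - ∠ p x q / 2) * D) ((∠ p y q / 2 - ∠ p x q / 2) * D)
    rw [sub_add_cancel, abs_mul _ D, abs_of_pos hDpos] at this
    linarith
  have hC : |∠ p y q / 2 - ∠ p x q / 2| = |∠ p y q - ∠ p x q| / 2 := by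
    rw [← sub_div, abs_div]; norm_num
  rw [hC] at hB
  have hE : 1 / dist x p + 1 / dist x q ≤ 2 / (dist x p * dist x q) := by
    rw [div_add_div _ _ hp0.ne' hq0.ne']
    gcongr
    linarith
  rw [← dist_eq_norm]
  calc _ ≤ 2 * D * (|∠ p y q - ∠ p x q| / 2) := hB
    _ ≤ 2 * D * ((3 * (dist y x * (2 / (dist x p * dist x q)))) / 2) := by
        gcongr
        refine hA.trans ?_
        gcongr
    _ = _ := by ring

end Analytic

section Frame

/-- Rotation by a right angle. -/
def rotJ (n : E2) : E2 := !₂[-n 1, n 0]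

lemma inner_E2 (z w : E2) : inner ℝ z w = z 0 * w 0 + z 1 * w 1 := by
  simp [PiLp.inner_apply, Fin.sum_univ_two, mul_comm]

lemma norm_E2 (z : E2) : ‖z‖ ^ 2 = z 0 ^ 2 + z 1 ^ 2 := by
  rw [← real_inner_self_eq_norm_sq, inner_E2]; ring

lemma unit_E2 {n : E2} (hn : ‖n‖ = 1) : n 0 ^ 2 + n 1 ^ 2 = 1 := by
  rw [← norm_E2, hn]; norm_num

lemma inner_rotJ (n z : E2) : inner ℝ (rotJ n) z = - n 1 * z 0 + n 0 * z 1 := by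
  rw [inner_E2]; simp [rotJ]

lemma frame {n : E2} (hn : ‖n‖ = 1) (z w : E2) :
    inner ℝ z w = inner ℝ n z * inner ℝ n w + inner ℝ (rotJ n) z * inner ℝ (rotJ n) w := by
  have h := unit_E2 hn
  rw [inner_rotJ, inner_rotJ, inner_E2, inner_E2, inner_E2]
  linear_combination (-(z 0 * w 0 + z 1 * w 1)) * h

lemma frame_norm {n : E2} (hn : ‖n‖ = 1) (z : E2) :
    ‖z‖ ^ 2 = inner ℝ n z ^ 2 + inner ℝ (rotJ n) z ^ 2 := by
  rw [← real_inner_self_eq_norm_sq, frame hn]; ring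

lemma frame_ext {n : E2} (hn : ‖n‖ = 1) (z : E2) (h1 : inner ℝ n z = 0)
    (h2 : inner ℝ (rotJ n) z = 0) : z = 0 := by
  have := frame_norm hn z
  rw [h1, h2] at this
  have h3 : ‖z‖ ^ 2 = 0 := by rw [this]; ring
  exact norm_eq_zero.mp (by simpa using h3)

lemma angle_lt_pi {n p q x : E2} (hp : 0 < inner ℝ n (p - x)) (hq : 0 < inner ℝ n (q - x)) :
    ∠ p x q < Real.pi := by
  refine lt_of_le_of_ne (InnerProductGeometry.angle_le_pi _ _) ?_
  intro h
  have h' : InnerProductGeometry.angle (p - x) (q - x) = Real.pi := h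
  rw [InnerProductGeometry.angle_eq_pi_iff] at h'
  obtain ⟨-, r, hr, he⟩ := h'
  rw [he, inner_smul_right] at hq
  nlinarith

/-- A large half-angle tangent forces both end points to be seen almost tangentially. -/
lemma tan_large {n p q x : E2} (hn : ‖n‖ = 1) {h M : ℝ} (hM : 4 ≤ M) (hh : 0 < h)
    (hp : inner ℝ n (p - x) = h) (hq : inner ℝ n (q - x) = h)
    (ht : 2 * M + 2 ≤ Real.tan (∠ p x q / 2)) :
    inner ℝ (rotJ n) (p - x) * inner ℝ (rotJ n) (q - x) < 0 ∧
      M * h ≤ |inner ℝ (rotJ n) (p - x)| ∧ M * h ≤ |inner ℝ (rotJ n) (q - x)| := by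
  have hpi : ∠ p x q < Real.pi := angle_lt_pi (n := n) (by rw [hp]; exact hh) (by rw [hq]; exact hh)
  have h0 : 0 ≤ ∠ p x q := InnerProductGeometry.angle_nonneg _ _
  have h1 := one_add_tan_sq_mul _ h0 hpi
  have h2 : Real.cos (∠ p x q) * (‖p - x‖ * ‖q - x‖) = inner ℝ (p - x) (q - x) :=
    InnerProductGeometry.cos_angle_mul_norm_mul_norm (p - x) (q - x)
  set t := Real.tan (∠ p x q / 2)
  set c := Real.cos (∠ p x q)
  set u := p - x
  set w := q - x
  have hu0 : 0 < ‖u‖ := by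
    rw [norm_pos_iff]; intro hz; rw [hz] at hp; simp at hp; linarith
  have hw0 : 0 < ‖w‖ := by
    rw [norm_pos_iff]; intro hz; rw [hz] at hq; simp at hq; linarith
  have ht2 : (2 * M + 2) ^ 2 ≤ t ^ 2 := by
    apply pow_le_pow_left₀ (by linarith) ht
  have hc : c < 0 := by nlinarith
  have hfr := frame hn u w
  rw [hp, hq] at hfr
  have hneg : inner ℝ u w < 0 := by rw [← h2]; exact mul_neg_of_neg_of_pos hc (by positivity)
  have hN : ‖‖w‖ • u + ‖u‖ • w‖ ^ 2 = 2 * ‖u‖ ^ 2 * ‖w‖ ^ 2 * (1 + c) := by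
    rw [norm_add_sq_real, norm_smul, norm_smul, inner_smul_left, inner_smul_right, ← h2]
    simp
    ring
  have hI : inner ℝ n (‖w‖ • u + ‖u‖ • w) = h * (‖u‖ + ‖w‖) := by
    rw [inner_add_right, inner_smul_right, inner_smul_right, hp, hq]; ring
  have hle : h * (‖u‖ + ‖w‖) ≤ ‖‖w‖ • u + ‖u‖ • w‖ := by
    rw [← hI]; have := real_inner_le_norm n (‖w‖ • u + ‖u‖ • w); rw [hn, one_mul] at this; exact this
  have hsq : (h * (‖u‖ + ‖w‖)) ^ 2 ≤ 2 * ‖u‖ ^ 2 * ‖w‖ ^ 2 * (1 + c) := by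
    rw [← hN]; exact pow_le_pow_left₀ (by positivity) hle 2
  have hmul : (h * (‖u‖ + ‖w‖)) ^ 2 * (1 + t ^ 2) ≤ 4 * (‖u‖ ^ 2 * ‖w‖ ^ 2) := by
    calc _ ≤ 2 * ‖u‖ ^ 2 * ‖w‖ ^ 2 * (1 + c) * (1 + t ^ 2) := by gcongr
      _ = 2 * ‖u‖ ^ 2 * ‖w‖ ^ 2 * ((1 + t ^ 2) * (1 + c)) := by ring
      _ = _ := by rw [h1]; ring
  have hA : h ^ 2 * (1 + t ^ 2) ≤ 4 * ‖u‖ ^ 2 := by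
    have : (h ^ 2 * (1 + t ^ 2)) * ‖w‖ ^ 2 ≤ (4 * ‖u‖ ^ 2) * ‖w‖ ^ 2 := by
      calc _ = (h * ‖w‖) ^ 2 * (1 + t ^ 2) := by ring
        _ ≤ (h * (‖u‖ + ‖w‖)) ^ 2 * (1 + t ^ 2) := by gcongr; linarith
        _ ≤ _ := hmul
        _ = _ := by ring
    exact le_of_mul_le_mul_right this (by positivity)
  have hB : h ^ 2 * (1 + t ^ 2) ≤ 4 * ‖w‖ ^ 2 := by
    have : (h ^ 2 * (1 + t ^ 2)) * ‖u‖ ^ 2 ≤ (4 * ‖w‖ ^ 2) * ‖u‖ ^ 2 := by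
      calc _ = (h * ‖u‖) ^ 2 * (1 + t ^ 2) := by ring
        _ ≤ (h * (‖u‖ + ‖w‖)) ^ 2 * (1 + t ^ 2) := by gcongr; linarith
        _ ≤ _ := hmul
        _ = _ := by ring
    exact le_of_mul_le_mul_right this (by positivity)
  rw [frame_norm hn u, hp] at hA
  rw [frame_norm hn w, hq] at hB
  have hh2 : h ^ 2 * (2 * M + 2) ^ 2 ≤ h ^ 2 * t ^ 2 := by gcongr
  refine ⟨by nlinarith, ?_, ?_⟩
  · apply le_of_sq_le_sq _ (abs_nonneg _)
    rw [sq_abs]; nlinarith [sq_nonneg h, mul_nonneg (sq_nonneg h) (by linarith : 0 ≤ M)]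
  · apply le_of_sq_le_sq _ (abs_nonneg _)
    rw [sq_abs]; nlinarith [sq_nonneg h, mul_nonneg (sq_nonneg h) (by linarith : 0 ≤ M)]

/-- Lower bound for the half-angle tangent at a nearest vertex. -/
lemma tan_lower {p q x : E2} {d : ℝ} (hd : 0 < d) (hpi : ∠ p x q < Real.pi)
    (hp : p ≠ x) (hq : q ≠ x)
    (hdpq : d ≤ dist p q) (hxp : dist x p ≤ 1) (hpq : dist x p ≤ dist x q)
    (hin : 0 ≤ inner ℝ (x - p) (q - p)) :
    2 / (1 + √(1 / (1 + d ^ 2 / 4))) - 1 ≤ Real.tan (∠ p x q / 2) ^ 2 := by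
  have h0 : 0 ≤ ∠ p x q := InnerProductGeometry.angle_nonneg _ _
  have h1 := one_add_tan_sq_mul _ h0 hpi
  have h2 : Real.cos (∠ p x q) = inner ℝ (p - x) (q - x) / (‖p - x‖ * ‖q - x‖) :=
    InnerProductGeometry.cos_angle (p - x) (q - x)
  have hu0 : 0 < ‖p - x‖ := norm_pos_iff.mpr (sub_ne_zero.mpr hp)
  have hw0 : 0 < ‖q - x‖ := norm_pos_iff.mpr (sub_ne_zero.mpr hq)
  rw [dist_comm, dist_eq_norm] at hxp
  rw [dist_comm x p, dist_comm x q, dist_eq_norm, dist_eq_norm] at hpq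
  rw [dist_comm, dist_eq_norm] at hdpq
  have e1 : inner ℝ (x - p) (q - p) = - inner ℝ (p - x) (q - p) := by
    rw [← inner_neg_left]; congr 1; abel
  have e2 : q - x = (p - x) + (q - p) := by abel
  have e3 : inner ℝ (p - x) (q - x) = ‖p - x‖ ^ 2 + inner ℝ (p - x) (q - p) := by
    rw [e2, inner_add_right, real_inner_self_eq_norm_sq]
  have e4 : ‖q - x‖ ^ 2 = ‖p - x‖ ^ 2 + 2 * inner ℝ (p - x) (q - p) + ‖q - p‖ ^ 2 := by
    rw [e2, norm_add_sq_real]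
  rw [e1] at hin
  set s := - inner ℝ (p - x) (q - p) with hs
  have hs' : inner ℝ (p - x) (q - p) = -s := by rw [hs]; ring
  rw [hs'] at e3 e4
  set U := ‖p - x‖
  set W := ‖q - x‖
  have hE : d ^ 2 ≤ ‖q - p‖ ^ 2 := pow_le_pow_left₀ hd.le hdpq 2
  have hUW : U ^ 2 ≤ W ^ 2 := pow_le_pow_left₀ hu0.le hpq 2
  have hU1 : U ^ 2 ≤ 1 := by nlinarith
  have hκ0 : 0 < 1 / (1 + d ^ 2 / 4) := by positivity
  set κ := √(1 / (1 + d ^ 2 / 4)) with hκ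
  have hκn : 0 ≤ κ := Real.sqrt_nonneg _
  have hκ2 : κ ^ 2 * (1 + d ^ 2 / 4) = 1 := by
    rw [hκ, Real.sq_sqrt hκ0.le]; field_simp
  have hcos : Real.cos (∠ p x q) ≤ κ := by
    rw [h2, e3, div_le_iff₀ (by positivity)]
    by_cases hneg : U ^ 2 - s ≤ 0
    · have : 0 ≤ κ * (U * W) := by positivity
      linarith
    push Not at hneg
    apply le_of_sq_le_sq _ (by positivity)
    have k1 : (U ^ 2 + -s) ^ 2 ≤ U ^ 2 * (U ^ 2 - s) := by nlinarith
    have k2 : (U ^ 2 - s) * (1 + d ^ 2 / 4) ≤ W ^ 2 := by nlinarith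
    have k3 : U ^ 2 - s ≤ κ ^ 2 * W ^ 2 := by
      calc U ^ 2 - s = κ ^ 2 * ((U ^ 2 - s) * (1 + d ^ 2 / 4)) := by
            linear_combination (-(U ^ 2 - s)) * hκ2
        _ ≤ _ := by gcongr
    calc _ ≤ U ^ 2 * (U ^ 2 - s) := k1
      _ ≤ U ^ 2 * (κ ^ 2 * W ^ 2) := by gcongr
      _ = _ := by ring
  have hpos : 0 < 1 + Real.cos (∠ p x q) := by nlinarith [sq_nonneg (Real.tan (∠ p x q / 2))]
  have h3 : 2 / (1 + κ) ≤ 1 + Real.tan (∠ p x q / 2) ^ 2 := by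
    rw [div_le_iff₀ (by positivity)]
    nlinarith [sq_nonneg (Real.tan (∠ p x q / 2))]
  linarith

lemma lower_const_pos {d : ℝ} (hd : 0 < d) : 0 < 2 / (1 + √(1 / (1 + d ^ 2 / 4))) - 1 := by
  have h1 : √(1 / (1 + d ^ 2 / 4)) < 1 := by
    rw [Real.sqrt_lt' one_pos, div_lt_iff₀ (by positivity)]
    nlinarith [sq_pos_of_pos hd]
  have h0 := Real.sqrt_nonneg (1 / (1 + d ^ 2 / 4))
  rw [sub_pos, lt_div_iff₀ (by positivity)]
  linarith

/-- Thin slabs do not contain large balls: two almost opposite normals are impossible. -/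
lemma normal_sign {a b M ρ h h' C1 C2 : ℝ} (hab : a ^ 2 + b ^ 2 = 1) (hM : 4 ≤ M)
    (hb : |b| * M ≤ 2) (hρ : 5 < 2 * ρ * M) (hC : C2 ^ 2 + C1 ^ 2 ≤ 1)
    (h1 : C2 ≤ h - ρ) (h2 : a * C2 + b * C1 ≤ h' - ρ) (hh : M * h ≤ 1) (hh' : M * h' ≤ 1) :
    1 / 2 ≤ a := by
  have hM0 : 0 < M := by linarith
  have hbM : (|b| * M) ^ 2 ≤ 4 := by
    have : 0 ≤ |b| * M := by positivity
    nlinarith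
  have hb2 : b ^ 2 * M ^ 2 ≤ 4 := by rw [mul_pow, sq_abs] at hbM; exact hbM
  have hb3 : b ^ 2 * M ≤ 1 := by nlinarith [sq_nonneg b, mul_nonneg (sq_nonneg b) hM0.le]
  have hb4 : b ^ 2 ≤ 1 / 4 := by nlinarith [sq_nonneg b]
  have hC1 : |C1| ≤ 1 := abs_le_of_sq_le_sq (by nlinarith [sq_nonneg C2]) (by norm_num)
  have hC2 : |C2| ≤ 1 := abs_le_of_sq_le_sq (by nlinarith [sq_nonneg C1]) (by norm_num)
  rcases le_or_gt 0 a with ha | ha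
  · nlinarith
  exfalso
  have ha1 : 0 ≤ 1 + a := by nlinarith [sq_nonneg b]
  have ha2 : 1 + a ≤ b ^ 2 := by nlinarith
  have k1 : -(|b| * 1) ≤ b * C1 := by
    have : |b * C1| ≤ |b| * 1 := by rw [abs_mul]; gcongr
    exact (abs_le.mp this).1
  have k2 : -((1 + a)) ≤ (1 + a) * C2 := by nlinarith [(abs_le.mp hC2).1]
  have k3 : -|b| - b ^ 2 ≤ h + h' - 2 * ρ := by nlinarith
  have k4 := mul_le_mul_of_nonneg_right k3 hM0.le
  nlinarith

/-- Two points seen on opposite sides force the second coordinate of a supporting normal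
to be small. -/
lemma slope_bound {b T1 T2 s c : ℝ} (hT : T1 * T2 < 0) (h1 : c ≤ |T1|) (h2 : c ≤ |T2|)
    (e1 : b * T1 ≤ s) (e2 : b * T2 ≤ s) : |b| * c ≤ s := by
  rcases mul_neg_iff.mp hT with ⟨p1, p2⟩ | ⟨p1, p2⟩
  · rw [abs_of_pos p1] at h1
    rw [abs_of_neg p2] at h2
    rcases le_total 0 b with hb | hb
    · rw [abs_of_nonneg hb]; nlinarith
    · rw [abs_of_nonpos hb]; nlinarith
  · rw [abs_of_neg p1] at h1
    rw [abs_of_pos p2] at h2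
    rcases le_total 0 b with hb | hb
    · rw [abs_of_nonneg hb]; nlinarith
    · rw [abs_of_nonpos hb]; nlinarith

/-- If `c` lies strictly between `a` and `b` there is a convex combination hitting it. -/
lemma exists_comb {a b c : ℝ} (h : (a - c) * (b - c) < 0) :
    ∃ l m : ℝ, 0 < l ∧ 0 < m ∧ l + m = 1 ∧ l * a + m * b = c := by
  have hne : b - a ≠ 0 := by intro h'; have : b = a := by linarith
                             subst this; nlinarith [mul_self_nonneg (b - c)]
  rcases mul_neg_iff.mp h with ⟨p1, p2⟩ | ⟨p1, p2⟩
  · refine ⟨(c - b) / (a - b), (a - c) / (a - b), div_pos (by linarith) (by linarith),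
      div_pos (by linarith) (by linarith), ?_, ?_⟩
    · have : a - b ≠ 0 := by linarith
      field_simp; ring
    · have : a - b ≠ 0 := by linarith
      field_simp; ring
  · refine ⟨(b - c) / (b - a), (c - a) / (b - a), div_pos (by linarith) (by linarith),
      div_pos (by linarith) (by linarith), ?_, ?_⟩
    · field_simp; ring
    · field_simp; ring

end Frame

section RealPart

lemma three_distinct {A B C : ℝ} (d1 : A ≠ C) (d2 : B ≠ C) (d3 : B ≠ A) :
    (A - C) * (B - C) < 0 ∨ (A - B) * (C - B) < 0 ∨ (B - A) * (C - A) < 0 := by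
  by_contra hcon
  push Not at hcon
  obtain ⟨h1, h2, h3⟩ := hcon
  have k1 : 0 < (A - C) ^ 2 := by have := sub_ne_zero.mpr d1; positivity
  have k2 : 0 < (B - C) ^ 2 := by have := sub_ne_zero.mpr d2; positivity
  have k3 : 0 < (B - A) ^ 2 := by have := sub_ne_zero.mpr d3; positivity
  have k4 := mul_nonneg h1 (mul_nonneg h2 h3)
  have k5 := mul_pos k1 (mul_pos k2 k3)
  nlinarith

lemma claimA_real {a b M ρ h h' T1 T2 S1 S2 X1 X2 Y1 Y2 C1 C2 : ℝ} (hM : 4 ≤ M)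
    (hρM : 5 < 2 * ρ * M)
    (hT : T1 * T2 < 0) (hT1 : M * h ≤ |T1|) (hT2 : M * h ≤ |T2|)
    (hS : S1 * S2 < 0) (hS1 : M * h' ≤ |S1|) (hS2 : M * h' ≤ |S2|)
    (hT1' : M * h ≤ 1) (hS1' : M * h' ≤ 1) (hab : a ^ 2 + b ^ 2 = 1)
    (c1 : C2 ≤ h - ρ) (c2 : a * C2 + b * C1 ≤ h' - ρ) (hC : C2 ^ 2 + C1 ^ 2 ≤ 1)
    (p1 : a * h + b * T1 ≤ h') (p2 : a * h + b * T2 ≤ h')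
    (q1 : a * h' - b * S1 ≤ h) (q2 : a * h' - b * S2 ≤ h) (q1' : Y1 ≤ h) (q2' : Y2 ≤ h)
    (y1 : a * Y1 + b * X1 = h') (y2 : a * Y2 + b * X2 = h')
    (x1 : X1 = b * h' + a * S1) (x2 : X2 = b * h' + a * S2) (hpos : 0 < h) (hpos' : 0 < h') :
    a * h + b * T1 = h' ∧ a * h + b * T2 = h' := by
  have hM0 : 0 < M := by linarith
  have ha1 : |a| ≤ 1 := abs_le_of_sq_le_sq (by linarith [sq_nonneg b]) (by norm_num)
  have ha2 := abs_le.mp ha1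
  have hb : |b| * M ≤ 2 := by
    rcases le_total h' h with hle | hle
    · have := slope_bound (b := b) (s := h' - a * h) hT hT1 hT2 (by linarith) (by linarith)
      have k0 : -1 * h ≤ a * h := mul_le_mul_of_nonneg_right ha2.1 hpos.le
      have k : (|b| * M) * h ≤ 2 * h := by rw [mul_assoc]; linarith
      exact le_of_mul_le_mul_right k hpos
    · have := slope_bound (b := -b) (s := h - a * h') hS hS1 hS2 (by linarith) (by linarith)
      rw [abs_neg] at this
      have k0 : -1 * h' ≤ a * h' := mul_le_mul_of_nonneg_right ha2.1 hpos'.le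
      have k : (|b| * M) * h' ≤ 2 * h' := by rw [mul_assoc]; linarith
      exact le_of_mul_le_mul_right k hpos'
  have ha := normal_sign hab hM hb hρM hC c1 c2 hT1' hS1'
  have hb1 : |b| ≤ 1 / 2 := by
    have := mul_le_mul_of_nonneg_left hM (abs_nonneg b)
    linarith
  have hb2 := abs_le.mp hb1
  have sgn1 : ∀ S : ℝ, 0 < S → M * h' ≤ |S| → 0 < b * h' + a * S := by
    intro S h0 h1
    rw [abs_of_pos h0] at h1
    have k1 : 4 * h' ≤ M * h' := mul_le_mul_of_nonneg_right hM hpos'.le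
    have k2 : (1 / 2) * S ≤ a * S := mul_le_mul_of_nonneg_right ha h0.le
    have k3 : -(1 / 2) * h' ≤ b * h' := mul_le_mul_of_nonneg_right (by linarith) hpos'.le
    linarith
  have sgn2 : ∀ S : ℝ, S < 0 → M * h' ≤ |S| → b * h' + a * S < 0 := by
    intro S h0 h1
    rw [abs_of_neg h0] at h1
    have k1 : 4 * h' ≤ M * h' := mul_le_mul_of_nonneg_right hM hpos'.le
    have k2 : a * S ≤ (1 / 2) * S := mul_le_mul_of_nonpos_right ha h0.le
    have k3 : b * h' ≤ (1 / 2) * h' := mul_le_mul_of_nonneg_right (by linarith) hpos'.le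
    linarith
  have hX : X1 * X2 < 0 := by
    rw [x1, x2]
    rcases mul_neg_iff.mp hS with ⟨s1, s2⟩ | ⟨s1, s2⟩
    · exact mul_neg_of_pos_of_neg (sgn1 _ s1 hS1) (sgn2 _ s2 hS2)
    · exact mul_neg_of_neg_of_pos (sgn2 _ s1 hS1) (sgn1 _ s2 hS2)
  obtain ⟨l, m, hl, hm, hlm, he⟩ := exists_comb (c := 0) (by simpa using hX)
  obtain ⟨l', m', hl', hm', hlm', he'⟩ := exists_comb (c := 0) (by simpa using hT)
  have r1 : a * (l * Y1 + m * Y2) = h' := by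
    linear_combination l * y1 + m * y2 - b * he + h' * hlm
  have r2 : l * Y1 + m * Y2 ≤ h := by
    have : l * h + m * h = h := by rw [← add_mul, hlm, one_mul]
    have e1 : l * Y1 ≤ l * h := mul_le_mul_of_nonneg_left q1' hl.le
    have e2 : m * Y2 ≤ m * h := mul_le_mul_of_nonneg_left q2' hm.le
    linarith
  have r3 : h' ≤ a * h := by rw [← r1]; gcongr
  have r4 : b * (l' * T1 + m' * T2) = 0 := by rw [he', mul_zero]
  have r5 : l' * (b * T1) + m' * (b * T2) = 0 := by linear_combination r4
  have r6 : b * T1 ≤ 0 := by linarith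
  have r7 : b * T2 ≤ 0 := by linarith
  have r8 : l' * (b * T1) ≤ 0 := mul_nonpos_of_nonneg_of_nonpos hl'.le r6
  have r9 : m' * (b * T2) ≤ 0 := mul_nonpos_of_nonneg_of_nonpos hm'.le r7
  have r10 : b * T1 = 0 := (mul_eq_zero.mp (by linarith : l' * (b * T1) = 0)).resolve_left hl'.ne'
  have r11 : b * T2 = 0 := (mul_eq_zero.mp (by linarith : m' * (b * T2) = 0)).resolve_left hm'.ne'
  have r12 : a * h ≤ h' := by linarith
  constructor <;> linarith

end RealPart

section Polygon

variable {n : ℕ} [NeZero n] (P : ConvexPolygon n)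

/-- `Supp P x k ν h`: `ν` is the outer unit normal of edge `k`, at height `h` above `x`. -/
structure Supp (x : E2) (k : Fin n) (ν : E2) (h : ℝ) : Prop where
  unit : ‖ν‖ = 1
  pos : 0 < h
  left : inner ℝ ν (P.v k - x) = h
  right : inner ℝ ν (P.v (k + 1) - x) = h
  le : ∀ z ∈ P.region, inner ℝ ν (z - x) ≤ h
  lt : ∀ m, m ≠ k → m ≠ k + 1 → inner ℝ ν (P.v m - x) < h

lemma v_mem (k : Fin n) : P.v k ∈ P.region := subset_convexHull ℝ _ (Set.mem_range_self k)

lemma region_convex : Convex ℝ P.region := convex_convexHull ℝ _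

lemma region_compact : IsCompact P.region := (Set.finite_range P.v).isCompact_convexHull ℝ

/-- A vertex is not strictly between two points of the region. -/
lemma not_between {ν A C : E2} (hν : ‖ν‖ = 1) (hA : A ∈ P.region) (hC : C ∈ P.region) (m : Fin n)
    (h1 : inner ℝ ν A = inner ℝ ν (P.v m)) (h2 : inner ℝ ν C = inner ℝ ν (P.v m))
    (h : (inner ℝ (rotJ ν) A - inner ℝ (rotJ ν) (P.v m)) *
      (inner ℝ (rotJ ν) C - inner ℝ (rotJ ν) (P.v m)) < 0) : False := by
  obtain ⟨l, k, hl, hk, hlk, he⟩ := exists_comb h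
  have hx : l • A + k • C = P.v m := by
    rw [← sub_eq_zero]
    apply frame_ext hν
    · rw [inner_sub_right, inner_add_right, inner_smul_right, inner_smul_right, h1, h2]
      linear_combination (inner ℝ ν (P.v m)) * hlk
    · rw [inner_sub_right, inner_add_right, inner_smul_right, inner_smul_right, he]; ring
  have hex := (P.extreme m).2 hA hC ⟨l, k, hl, hk, hlk, hx⟩
  have : A = P.v m := by exact hex
  rw [this] at h
  simp at h

lemma exists_supp (hinj : Function.Injective P.v) {x : E2} (hx : x ∈ interior P.region)
    (k : Fin n) (hk : k + 1 ≠ k) : ∃ ν h, Supp P x k ν h := by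
  set mid := (1 / 2 : ℝ) • P.v k + (1 / 2 : ℝ) • P.v (k + 1) with hmid
  have hfr : mid ∈ frontier P.region := by
    have : frontier P.region = ⋃ i, segment ℝ (P.v i) (P.v (i + 1)) := P.boundary
    rw [this]
    exact Set.mem_iUnion.mpr ⟨k, 1 / 2, 1 / 2, by norm_num, by norm_num, by norm_num, rfl⟩
  have hnot : mid ∉ interior P.region := fun h => hfr.2 h
  obtain ⟨f, hf⟩ := geometric_hahn_banach_open_point (region_convex P).interior isOpen_interior hnot
  have hcl : ∀ z ∈ P.region, f z ≤ f mid := by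
    intro z hz
    have hz' : z ∈ closure (interior P.region) := by
      rw [(region_convex P).closure_interior_eq_closure_of_nonempty_interior ⟨x, hx⟩]
      exact subset_closure hz
    have hc : IsClosed {z : E2 | f z ≤ f mid} := isClosed_le f.continuous continuous_const
    exact closure_minimal (fun a ha => (hf a ha).le) hc hz'
  have hm : f mid = (f (P.v k) + f (P.v (k + 1))) / 2 := by
    rw [hmid, map_add, map_smul, map_smul]; simp only [smul_eq_mul]; ring
  have f1 := hcl _ (v_mem P k)
  have f2 := hcl _ (v_mem P (k + 1))
  set N : E2 := (InnerProductSpace.toDual ℝ E2).symm f with hN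
  have hNf : ∀ z, inner ℝ N z = f z := fun z => by
    rw [hN, InnerProductSpace.toDual_symm_apply]
  have hN0 : N ≠ 0 := by
    intro h0
    have h1 := hf x hx
    rw [← hNf, ← hNf, h0] at h1
    simp at h1
  have hNp : 0 < ‖N‖ := norm_pos_iff.mpr hN0
  have hin : ∀ z w : E2, inner ℝ (‖N‖⁻¹ • N) (z - w) = ‖N‖⁻¹ * (f z - f w) := by
    intro z w
    rw [inner_smul_left, hNf, map_sub]; simp
  have hunit : ‖(‖N‖⁻¹ • N)‖ = 1 := by
    rw [norm_smul, norm_inv, norm_norm, inv_mul_cancel₀ hNp.ne']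
  refine ⟨‖N‖⁻¹ • N, ‖N‖⁻¹ * (f mid - f x), hunit, ?_, ?_, ?_, ?_, ?_⟩
  · have := hf x hx
    have h3 : 0 < f mid - f x := by linarith
    positivity
  · rw [hin]; congr 2; linarith
  · rw [hin]; congr 2; linarith
  · intro z hz
    rw [hin]
    have := hcl z hz
    gcongr
  · intro m hm1 hm2
    rw [hin]
    have hmlt : f (P.v m) < f mid := by
      refine lt_of_le_of_ne (hcl _ (v_mem P m)) ?_
      intro heq
      set ν := ‖N‖⁻¹ • N with hνd
      have hν : ∀ z : E2, inner ℝ ν z = ‖N‖⁻¹ * f z := by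
        intro z; have := hin z 0; simpa using this
      have ea : inner ℝ ν (P.v k) = ‖N‖⁻¹ * f mid := by rw [hν]; congr 1; linarith
      have eb : inner ℝ ν (P.v (k + 1)) = ‖N‖⁻¹ * f mid := by rw [hν]; congr 1; linarith
      have ec : inner ℝ ν (P.v m) = ‖N‖⁻¹ * f mid := by rw [hν, heq]
      have key : ∀ i j : Fin n, i ≠ j → inner ℝ ν (P.v i) = inner ℝ ν (P.v j) →
          inner ℝ (rotJ ν) (P.v i) ≠ inner ℝ (rotJ ν) (P.v j) := by
        intro i j hij h1 h2
        apply hij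
        apply hinj
        rw [← sub_eq_zero]
        apply frame_ext hunit
        · rw [inner_sub_right, h1, sub_self]
        · rw [inner_sub_right, h2, sub_self]
      have d1 := key k m hm1.symm (ea.trans ec.symm)
      have d2 := key (k + 1) m hm2.symm (eb.trans ec.symm)
      have d3 := key (k + 1) k hk (eb.trans ea.symm)
      have n1 := not_between P hunit (v_mem P k) (v_mem P (k + 1)) m (ea.trans ec.symm)
        (eb.trans ec.symm)
      have n2 := not_between P hunit (v_mem P k) (v_mem P m) (k + 1) (ea.trans eb.symm)
        (ec.trans eb.symm)
      have n3 := not_between P hunit (v_mem P (k + 1)) (v_mem P m) k (eb.trans ea.symm)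
        (ec.trans ea.symm)
      generalize inner ℝ (rotJ ν) (P.v k) = A at *
      generalize inner ℝ (rotJ ν) (P.v (k + 1)) = B at *
      generalize inner ℝ (rotJ ν) (P.v m) = C at *
      rcases three_distinct d1 d2 d3 with q | q | q
      · exact n1 q
      · exact n2 q
      · exact n3 q
    have : f (P.v m) - f x < f mid - f x := by linarith
    gcongr

variable {P}

lemma Supp.ball {x : E2} {k : Fin n} {ν : E2} {h : ℝ} (S : Supp P x k ν h) {c : E2} {ρ : ℝ}
    (hρ : 0 ≤ ρ) (hc : Metric.closedBall c ρ ⊆ P.region) : inner ℝ ν (c - x) ≤ h - ρ := by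
  have hz : c + ρ • ν ∈ P.region := by
    apply hc
    rw [Metric.mem_closedBall, dist_eq_norm, add_sub_cancel_left, norm_smul, S.unit]
    simp [abs_of_nonneg hρ]
  have h1 := S.le _ hz
  have h2 : c + ρ • ν - x = (c - x) + ρ • ν := by abel
  rw [h2, inner_add_right, inner_smul_right, real_inner_self_eq_norm_sq, S.unit] at h1
  linarith

lemma Supp.angle_lt_pi {x : E2} {k : Fin n} {ν : E2} {h : ℝ} (S : Supp P x k ν h) :
    ∠ (P.v k) x (P.v (k + 1)) < Real.pi :=
  _root_.angle_lt_pi (n := ν) (by rw [S.left]; exact S.pos) (by rw [S.right]; exact S.pos)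

lemma Supp.left_ne {x : E2} {k : Fin n} {ν : E2} {h : ℝ} (S : Supp P x k ν h) : P.v k ≠ x := by
  intro he
  have h1 := S.left
  rw [he] at h1
  simp at h1
  linarith [S.pos]

lemma one_ne (hn : 3 ≤ n) : (1 : Fin n) ≠ 0 := by
  intro h
  have := congrArg Fin.val h
  rw [Fin.val_one', Fin.val_zero, Nat.mod_eq_of_lt (by omega)] at this
  omega

lemma two_ne (hn : 3 ≤ n) : (1 + 1 : Fin n) ≠ 0 := by
  intro h
  have := congrArg Fin.val h
  rw [Fin.val_add, Fin.val_one', Fin.val_zero, Nat.mod_eq_of_lt (by omega : 1 < n),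
    Nat.mod_eq_of_lt (by omega)] at this
  omega

lemma rot_inner_abs {ν z : E2} (hν : ‖ν‖ = 1) : |inner ℝ (rotJ ν) z| ≤ ‖z‖ := by
  apply abs_le_of_sq_le_sq _ (norm_nonneg _)
  rw [frame_norm hν z]
  nlinarith [sq_nonneg (inner ℝ ν z)]

/-- Two different edges cannot both be seen from `x` under an angle close to `π`. -/
lemma claimA {x c : E2} {i j : Fin n} {ν ν' : E2} {h h' M ρ : ℝ}
    (Si : Supp P x i ν' h') (Sj : Supp P x j ν h) (hij : i ≠ j)
    (hr : ∀ z ∈ P.region, ‖z - x‖ ≤ 1) (hρ : 0 ≤ ρ) (hc : Metric.closedBall c ρ ⊆ P.region)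
    (hM : 4 ≤ M) (hρM : 5 < 2 * ρ * M)
    (hti : 2 * M + 2 ≤ Real.tan (∠ (P.v i) x (P.v (i + 1)) / 2))
    (htj : 2 * M + 2 ≤ Real.tan (∠ (P.v j) x (P.v (j + 1)) / 2)) : False := by
  have hM0 : 0 < M := by linarith
  have hcr : c ∈ P.region := hc (Metric.mem_closedBall_self hρ)
  obtain ⟨hT, hT1, hT2⟩ := tan_large Sj.unit hM Sj.pos Sj.left Sj.right htj
  obtain ⟨hS, hS1, hS2⟩ := tan_large Si.unit hM Si.pos Si.left Si.right hti
  have hT1' := hT1.trans ((rot_inner_abs Sj.unit).trans (hr _ (v_mem P j)))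
  have hS1' := hS1.trans ((rot_inner_abs Si.unit).trans (hr _ (v_mem P i)))
  have hab : inner ℝ ν ν' ^ 2 + inner ℝ (rotJ ν) ν' ^ 2 = 1 := by
    rw [← frame_norm Sj.unit, Si.unit]; norm_num
  have E1 : ∀ z, inner ℝ ν' z = inner ℝ ν ν' * inner ℝ ν z +
      inner ℝ (rotJ ν) ν' * inner ℝ (rotJ ν) z := fun z => frame Sj.unit ν' z
  have E2' : ∀ z, inner ℝ ν z = inner ℝ ν ν' * inner ℝ ν' z -
      inner ℝ (rotJ ν) ν' * inner ℝ (rotJ ν') z := fun z => by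
    rw [frame Si.unit ν z, real_inner_comm ν ν']
    have : inner ℝ (rotJ ν') ν = - inner ℝ (rotJ ν) ν' := by rw [inner_rotJ, inner_rotJ]; ring
    rw [this]; ring
  have E3 : ∀ z, inner ℝ (rotJ ν) z = inner ℝ (rotJ ν) ν' * inner ℝ ν' z +
      inner ℝ ν ν' * inner ℝ (rotJ ν') z := fun z => by
    rw [frame Si.unit (rotJ ν) z, real_inner_comm ν' (rotJ ν)]
    have : inner ℝ (rotJ ν') (rotJ ν) = inner ℝ ν ν' := by
      rw [inner_rotJ, inner_E2]; simp [rotJ]; ring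
    rw [this]
    try rw [real_inner_comm (rotJ ν) ν']
  have c1 := Sj.ball hρ hc
  have c2 := Si.ball hρ hc
  rw [E1] at c2
  have hC : inner ℝ ν (c - x) ^ 2 + inner ℝ (rotJ ν) (c - x) ^ 2 ≤ 1 := by
    rw [← frame_norm Sj.unit]; have := hr c hcr; nlinarith [norm_nonneg (c - x)]
  -- positions of the vertices of edge j w.r.t. edge i and conversely
  have p1 := Si.le _ (v_mem P j)
  have p2 := Si.le _ (v_mem P (j + 1))
  rw [E1, Sj.left] at p1
  rw [E1, Sj.right] at p2
  have q1 := Sj.le _ (v_mem P i)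
  have q2 := Sj.le _ (v_mem P (i + 1))
  have q1' := q1
  have q2' := q2
  rw [E2', Si.left] at q1
  rw [E2', Si.right] at q2
  have y1 := Si.left
  have y2 := Si.right
  rw [E1] at y1 y2
  have x1 := E3 (P.v i - x)
  have x2 := E3 (P.v (i + 1) - x)
  rw [Si.left] at x1
  rw [Si.right] at x2
  have hv1 := E1 (P.v j - x)
  have hv2 := E1 (P.v (j + 1) - x)
  rw [Sj.left] at hv1
  rw [Sj.right] at hv2
  have hpos := Sj.pos
  have hpos' := Si.pos
  suffices hz : inner ℝ ν' (P.v j - x) = h' ∧ inner ℝ ν' (P.v (j + 1) - x) = h' by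
    have z1 : j = i ∨ j = i + 1 := by
      by_contra hcon
      push Not at hcon
      exact absurd hz.1 (Si.lt j hcon.1 hcon.2).ne
    have z2 : j + 1 = i ∨ j + 1 = i + 1 := by
      by_contra hcon
      push Not at hcon
      exact absurd hz.2 (Si.lt (j + 1) hcon.1 hcon.2).ne
    rcases z1 with z1 | z1
    · exact hij z1.symm
    · rcases z2 with z2 | z2
      · rw [z1, add_assoc] at z2
        exact two_ne P.hn (by simpa using z2)
      · exact hij (add_right_cancel z2).symm
  rw [hv1, hv2]
  generalize inner ℝ (rotJ ν) (P.v j - x) = T1 at *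
  generalize inner ℝ (rotJ ν) (P.v (j + 1) - x) = T2 at *
  generalize inner ℝ (rotJ ν') (P.v i - x) = S1 at *
  generalize inner ℝ (rotJ ν') (P.v (i + 1) - x) = S2 at *
  generalize inner ℝ (rotJ ν) (P.v i - x) = X1 at *
  generalize inner ℝ (rotJ ν) (P.v (i + 1) - x) = X2 at *
  generalize inner ℝ ν (P.v i - x) = Y1 at *
  generalize inner ℝ ν (P.v (i + 1) - x) = Y2 at *
  generalize inner ℝ ν ν' = a at *
  generalize inner ℝ (rotJ ν) ν' = b at *
  exact claimA_real hM hρM hT hT1 hT2 hS hS1 hS2 hT1' hS1' hab c1 c2 hC p1 p2 q1 q2 q1' q2'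
    y1 y2 x1 x2 hpos hpos'

end Polygon

section Final

lemma claimB_real {a b M ρ h h' T1 T2 X Y C1 C2 d : ℝ} (hM : 4 ≤ M)
    (hρM : 5 < 2 * ρ * M) (hd : 0 < d) (hd1 : d ≤ 1)
    (hT : T1 * T2 < 0) (hT1 : M * h ≤ |T1|) (hT2 : M * h ≤ |T2|)
    (hn1 : (d / 2) ^ 2 ≤ h ^ 2 + T1 ^ 2) (hn2 : (d / 2) ^ 2 ≤ h ^ 2 + T2 ^ 2)
    (hT1' : M * h ≤ 1) (hab : a ^ 2 + b ^ 2 = 1)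
    (c1 : C2 ≤ h - ρ) (c2 : a * C2 + b * C1 ≤ h' - ρ) (hC : C2 ^ 2 + C1 ^ 2 ≤ 1)
    (p1 : a * h + b * T1 ≤ h') (p2 : a * h + b * T2 ≤ h')
    (y1 : a * Y + b * X = h') (hX : |X| < d / 4) (hh' : M * h' ≤ d / 4)
    (hY : Y < h) (hpos : 0 < h) : False := by
  have hM0 : 0 < M := by linarith
  have low : ∀ T : ℝ, M * h ≤ |T| → (d / 2) ^ 2 ≤ h ^ 2 + T ^ 2 → d / 4 ≤ |T| := by
    intro T h1 h2
    have k1 : h ≤ |T| := by nlinarith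
    have k2 : h ^ 2 ≤ T ^ 2 := by rw [← sq_abs T]; exact pow_le_pow_left₀ hpos.le k1 2
    apply le_of_sq_le_sq _ (abs_nonneg _)
    rw [sq_abs]
    nlinarith
  have l1 := low T1 hT1 hn1
  have l2 := low T2 hT2 hn2
  have ha1 : |a| ≤ 1 := abs_le_of_sq_le_sq (by linarith [sq_nonneg b]) (by norm_num)
  have ha2 := abs_le.mp ha1
  have hb : |b| * M ≤ 2 := by
    have hsl := slope_bound (b := b) (s := h' - a * h) hT (max_le hT1 l1) (max_le hT2 l2)
      (by linarith) (by linarith)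
    have m1 := le_max_left (M * h) (d / 4)
    have m2 := le_max_right (M * h) (d / 4)
    generalize max (M * h) (d / 4) = c at *
    have hc : 0 < c := by linarith
    have k0 : -1 * h ≤ a * h := mul_le_mul_of_nonneg_right ha2.1 hpos.le
    have k1 : M * (|b| * c) ≤ M * (h' + h) := mul_le_mul_of_nonneg_left (by linarith) hM0.le
    have k : (|b| * M) * c ≤ 2 * c := by linarith
    exact le_of_mul_le_mul_right k hc
  have ha := normal_sign hab hM hb hρM hC c1 c2 hT1' (by linarith)
  have hX2 := abs_lt.mp hX
  have hTX : (T1 - X) * (T2 - X) < 0 := by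
    rcases mul_neg_iff.mp hT with ⟨s1, s2⟩ | ⟨s1, s2⟩
    · rw [abs_of_pos s1] at l1
      rw [abs_of_neg s2] at l2
      exact mul_neg_of_pos_of_neg (by linarith) (by linarith)
    · rw [abs_of_neg s1] at l1
      rw [abs_of_pos s2] at l2
      exact mul_neg_of_neg_of_pos (by linarith) (by linarith)
  obtain ⟨l, m, hl, hm, hlm, he⟩ := exists_comb hTX
  have e1 := mul_le_mul_of_nonneg_left p1 hl.le
  have e2 := mul_le_mul_of_nonneg_left p2 hm.le
  have e3 : l * (a * h + b * T1) + m * (a * h + b * T2) = a * h + b * X := by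
    linear_combination (a * h) * hlm + b * he
  have e4 : l * h' + m * h' = h' := by rw [← add_mul, hlm, one_mul]
  have e5 : a * h ≤ a * Y := by linarith
  have e6 : a * Y < a * h := mul_lt_mul_of_pos_left hY (by linarith)
  linarith

variable {n : ℕ} [NeZero n] {P : ConvexPolygon n}

/-- Close to a vertex, edges not containing it are not seen under an angle close to `π`. -/
lemma claimB {x c : E2} {m j : Fin n} {ν ν' : E2} {h h' M ρ d : ℝ}
    (Sm : Supp P x m ν' h') (Sj : Supp P x j ν h) (hm1 : m ≠ j) (hm2 : m ≠ j + 1)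
    (hr : ∀ z ∈ P.region, ‖z - x‖ ≤ 1) (hρ : 0 ≤ ρ) (hc : Metric.closedBall c ρ ⊆ P.region)
    (hM : 4 ≤ M) (hρM : 5 < 2 * ρ * M) (hd : 0 < d) (hd1 : d ≤ 1)
    (hR : ‖P.v m - x‖ < d / (4 * M))
    (hj1 : d / 2 ≤ ‖P.v j - x‖) (hj2 : d / 2 ≤ ‖P.v (j + 1) - x‖)
    (htj : 2 * M + 2 ≤ Real.tan (∠ (P.v j) x (P.v (j + 1)) / 2)) : False := by
  have hM0 : 0 < M := by linarith
  have hcr : c ∈ P.region := hc (Metric.mem_closedBall_self hρ)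
  obtain ⟨hT, hT1, hT2⟩ := tan_large Sj.unit hM Sj.pos Sj.left Sj.right htj
  have hT1' := hT1.trans ((rot_inner_abs Sj.unit).trans (hr _ (v_mem P j)))
  have hab : inner ℝ ν ν' ^ 2 + inner ℝ (rotJ ν) ν' ^ 2 = 1 := by
    rw [← frame_norm Sj.unit, Sm.unit]; norm_num
  have E1 : ∀ z, inner ℝ ν' z = inner ℝ ν ν' * inner ℝ ν z +
      inner ℝ (rotJ ν) ν' * inner ℝ (rotJ ν) z := fun z => frame Sj.unit ν' z
  have c1 := Sj.ball hρ hc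
  have c2 := Sm.ball hρ hc
  rw [E1] at c2
  have hC : inner ℝ ν (c - x) ^ 2 + inner ℝ (rotJ ν) (c - x) ^ 2 ≤ 1 := by
    rw [← frame_norm Sj.unit]; have := hr c hcr; nlinarith [norm_nonneg (c - x)]
  have p1 := Sm.le _ (v_mem P j)
  have p2 := Sm.le _ (v_mem P (j + 1))
  rw [E1, Sj.left] at p1
  rw [E1, Sj.right] at p2
  have y1 := Sm.left
  rw [E1] at y1
  have hn1 : (d / 2) ^ 2 ≤ h ^ 2 + inner ℝ (rotJ ν) (P.v j - x) ^ 2 := by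
    rw [← Sj.left, ← frame_norm Sj.unit]; exact pow_le_pow_left₀ (by positivity) hj1 2
  have hn2 : (d / 2) ^ 2 ≤ h ^ 2 + inner ℝ (rotJ ν) (P.v (j + 1) - x) ^ 2 := by
    rw [← Sj.right, ← frame_norm Sj.unit]; exact pow_le_pow_left₀ (by positivity) hj2 2
  have hRM : M * ‖P.v m - x‖ ≤ d / 4 := by
    rw [lt_div_iff₀ (by positivity)] at hR; linarith
  have hh' : M * h' ≤ d / 4 := by
    have : h' ≤ ‖P.v m - x‖ := by
      rw [← Sm.left]
      have := real_inner_le_norm ν' (P.v m - x)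
      rwa [Sm.unit, one_mul] at this
    exact (mul_le_mul_of_nonneg_left this hM0.le).trans hRM
  have hX : |inner ℝ (rotJ ν) (P.v m - x)| < d / 4 := by
    refine lt_of_le_of_lt (rot_inner_abs Sj.unit) ?_
    have := mul_le_mul_of_nonneg_right hM (norm_nonneg (P.v m - x))
    linarith
  exact claimB_real hM hρM hd hd1 hT hT1 hT2 hn1 hn2 hT1' hab c1 c2 hC p1 p2 y1 hX hh'
    (Sj.lt m hm1 hm2) Sj.pos

/-- At every vertex one of the two edges makes a non-obtuse angle with the direction of `x`. -/
lemma edge_dir {x : E2} {m k : Fin n} {ν ν' : E2} {h h' : ℝ}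
    (S : Supp P x m ν h) (S' : Supp P x k ν' h') (hk : k + 1 = m) (hk1 : k ≠ m)
    (hk2 : k ≠ m + 1) (hk3 : m + 1 ≠ m) :
    0 ≤ inner ℝ (x - P.v m) (P.v (m + 1) - P.v m) ∨ 0 ≤ inner ℝ (x - P.v m) (P.v k - P.v m) := by
  by_contra hcon
  push Not at hcon
  obtain ⟨g1, g2⟩ := hcon
  have a1 : inner ℝ ν (P.v (m + 1) - P.v m) = 0 := by
    have := S.right; rw [← S.left] at this
    rw [inner_sub_right, inner_sub_right] at this; rw [inner_sub_right]; linarith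
  have a2 : inner ℝ ν (P.v k - P.v m) < 0 := by
    have := S.lt k hk1 hk2; rw [← S.left] at this
    rw [inner_sub_right, inner_sub_right] at this; rw [inner_sub_right]; linarith
  have a3 : inner ℝ ν (x - P.v m) < 0 := by
    have := S.left; have := S.pos
    rw [inner_sub_right] at *; linarith
  have b1 : inner ℝ ν' (P.v k - P.v m) = 0 := by
    have := S'.right; rw [← S'.left, hk] at this
    rw [inner_sub_right, inner_sub_right] at this; rw [inner_sub_right]; linarith
  have b2 : inner ℝ ν' (P.v (m + 1) - P.v m) < 0 := by
    have := S'.lt (m + 1) hk2.symm (by rw [hk]; exact hk3)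
    have hh := S'.right
    rw [hk] at hh
    rw [← hh] at this
    rw [inner_sub_right, inner_sub_right] at this; rw [inner_sub_right]; linarith
  have b3 : inner ℝ ν' (x - P.v m) < 0 := by
    have := S'.right; have := S'.pos
    rw [hk] at *
    rw [inner_sub_right] at *; linarith
  have E1 : ∀ z w, inner ℝ z w = inner ℝ ν z * inner ℝ ν w +
      inner ℝ (rotJ ν) z * inner ℝ (rotJ ν) w := fun z w => frame S.unit z w
  rw [E1, a1] at g1 b2
  rw [E1] at g2 b1 b3
  generalize inner ℝ ν (P.v k - P.v m) = A2 at *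
  generalize inner ℝ ν (x - P.v m) = H at *
  generalize inner ℝ ν ν' = a at *
  generalize inner ℝ (rotJ ν) ν' = b at *
  generalize inner ℝ (rotJ ν) (P.v k - P.v m) = F at *
  generalize inner ℝ (rotJ ν) (P.v (m + 1) - P.v m) = E at *
  generalize inner ℝ (rotJ ν) (x - P.v m) = G at *
  clear E1
  simp only [mul_zero, zero_add] at g1 b2
  have hbG : 0 < b * G := by
    have h1 := mul_pos_of_neg_of_neg g1 b2
    have h2 : 0 < (b * G) * E ^ 2 := by linarith
    exact pos_of_mul_pos_left h2 (sq_nonneg E)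
  have ha : 0 < a := by
    have h1 : a * H < 0 := by linarith
    by_contra hn
    push Not at hn
    have := mul_nonneg_of_nonpos_of_nonpos hn a3.le
    linarith
  have hbF : 0 < b * F := by
    have := mul_neg_of_pos_of_neg ha a2
    linarith
  have hGF : 0 < G * F := by
    have h1 := mul_pos hbG hbF
    have h2 : 0 < (G * F) * b ^ 2 := by linarith
    exact pos_of_mul_pos_left h2 (sq_nonneg b)
  have := mul_pos_of_neg_of_neg a3 a2
  linarith

lemma final_real {K c δ R W ti tj C1 : ℝ} (hc : 0 < c) (hK : 0 < K) (hti : 0 ≤ ti) (htj : 0 ≤ tj)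
    (hC1 : 0 < C1) (h1 : c ≤ R * W) (h2 : ti ≤ C1 * (R * W)) (h3 : tj ≤ C1 * (R * W))
    (hmin : ti ≤ K ∨ tj ≤ K) :
    (1 + ti ^ 2) * tj ≤ (K * (1 / c ^ 2 + C1 ^ 2) + (1 + K ^ 2) * (C1 / c)) * (R * W) ^ 2 := by
  generalize R * W = Z at *
  have hZ : 0 < Z := by linarith
  have z1 : 1 ≤ (1 / c) * Z := by rw [one_div, inv_mul_eq_div, le_div_iff₀ hc]; linarith
  have z2 : 1 ≤ (1 / c ^ 2) * Z ^ 2 := by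
    have : (1 / c ^ 2) * Z ^ 2 = ((1 / c) * Z) ^ 2 := by ring
    rw [this]; exact one_le_pow₀ z1
  have z3 : ti ^ 2 ≤ C1 ^ 2 * Z ^ 2 := by rw [← mul_pow]; exact pow_le_pow_left₀ hti h2 2
  have p1 : 0 ≤ (1 + K ^ 2) * (C1 / c) * Z ^ 2 := by positivity
  have p2 : 0 ≤ K * (1 / c ^ 2 + C1 ^ 2) * Z ^ 2 := by positivity
  rcases hmin with h | h
  · have e1 : (1 + ti ^ 2) * tj ≤ (1 + K ^ 2) * (C1 * Z * 1) := by
      rw [mul_one]; gcongr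
    have e2 : (1 + K ^ 2) * (C1 * Z * 1) ≤ (1 + K ^ 2) * (C1 * Z * ((1 / c) * Z)) := by gcongr
    have e3 : (1 + K ^ 2) * (C1 * Z * ((1 / c) * Z)) = (1 + K ^ 2) * (C1 / c) * Z ^ 2 := by ring
    rw [add_mul]; linarith
  · have e1 : (1 + ti ^ 2) * tj ≤ ((1 / c ^ 2) * Z ^ 2 + C1 ^ 2 * Z ^ 2) * K := by gcongr
    rw [add_mul]; linarith

lemma exists_ball {γ : ℝ} (hγ : 0 < γ) (hdiam : Metric.diam P.region = 1) (hG : P.G1 γ) {x : E2}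
    (hx : x ∈ interior P.region) : ∃ c, Metric.closedBall c (1 / γ) ⊆ P.region := by
  have hbd : Bornology.IsBounded P.region := (region_compact P).isBounded
  have hbdd : BddAbove {r : ℝ | ∃ c : E2, Metric.closedBall c r ⊆ P.region} := by
    refine ⟨1, ?_⟩
    rintro r ⟨c, hc⟩
    by_contra hr
    push Not at hr
    have h1 : c ∈ P.region := hc (Metric.mem_closedBall_self (by linarith))
    have h2 : c + EuclideanSpace.single (0 : Fin 2) r ∈ P.region := by
      apply hc
      rw [Metric.mem_closedBall, dist_eq_norm, add_sub_cancel_left]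
      simp [abs_of_pos (by linarith : 0 < r)]
    have h3 := Metric.dist_le_diam_of_mem hbd h2 h1
    rw [hdiam, dist_eq_norm, add_sub_cancel_left] at h3
    simp [abs_of_pos (by linarith : 0 < r)] at h3
    linarith
  obtain ⟨ε, hε, hball⟩ := Metric.nhds_basis_closedBall.mem_iff.mp (mem_interior_iff_mem_nhds.mp hx)
  have hpos : 0 < P.inradius := lt_of_lt_of_le hε (le_csSup hbdd ⟨x, hball⟩)
  have hlt : 1 / γ < P.inradius := by
    unfold ConvexPolygon.G1 at hG
    rw [hdiam, div_lt_iff₀ hpos] at hG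
    rw [div_lt_iff₀ hγ]; linarith
  have hne : {r : ℝ | ∃ c : E2, Metric.closedBall c r ⊆ P.region}.Nonempty := ⟨ε, x, hball⟩
  have hlt' : 1 / γ < sSup {r : ℝ | ∃ c : E2, Metric.closedBall c r ⊆ P.region} := hlt
  obtain ⟨r, ⟨c, hc⟩, hr⟩ := exists_lt_of_lt_csSup hne hlt'
  exact ⟨c, (Metric.closedBall_subset_closedBall hr.le).trans hc⟩

end Final

open ConvexPolygon in
/-- Lemma 3: under G1 and G2 there is a uniform constant `C₂` bounding
`‖∇t_i(x)‖ t_j(x)/(r_a(x) r_b(x))` by `C₂ (Σ_k w_k)²` for `i ≠ j`, `a ≠ b`. -/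
theorem lemma_two_bound (γstar dstar : ℝ) (hγ : 0 < γstar) (hd : 0 < dstar) :
    ∃ C₂ : ℝ, 0 < C₂ ∧
      ∀ (n : ℕ) [NeZero n] (P : ConvexPolygon n),
        Metric.diam P.region = 1 → P.G1 γstar → P.G2 dstar →
        ∀ x ∈ interior P.region, ∀ i j a b : Fin n, i ≠ j → a ≠ b →
          ‖gradient (fun y : E2 => Real.tan (P.angleAt i y / 2)) x‖ * P.t j x /
              (P.r a x * P.r b x)
            ≤ C₂ * (∑ k : Fin n, P.w k x) ^ 2 := by
  obtain ⟨M, hMdef⟩ : ∃ M : ℝ, M = 4 + 4 * γstar := ⟨_, rfl⟩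
  have hM : 4 ≤ M := by linarith
  have hM0 : 0 < M := by linarith
  have hρM : 5 < 2 * (1 / γstar) * M := by
    have : 2 * (1 / γstar) * M = 8 / γstar + 8 := by rw [hMdef]; field_simp; ring
    rw [this]
    have : 0 < 8 / γstar := by positivity
    linarith
  obtain ⟨K, hKdef⟩ : ∃ K : ℝ, K = 2 * M + 2 := ⟨_, rfl⟩
  have hK : 0 < K := by linarith
  obtain ⟨δ, hδdef⟩ : ∃ δ : ℝ, δ = dstar / (4 * M) := ⟨_, rfl⟩
  have hδ : 0 < δ := by rw [hδdef]; positivity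
  obtain ⟨c, hcdef⟩ : ∃ c : ℝ, c = √(2 / (1 + √(1 / (1 + dstar ^ 2 / 4))) - 1) := ⟨_, rfl⟩
  have hc : 0 < c := by rw [hcdef]; exact Real.sqrt_pos.mpr (lower_const_pos hd)
  obtain ⟨C1, hC1def⟩ : ∃ C1 : ℝ, C1 = 1 + K / c + 1 / δ := ⟨_, rfl⟩
  have hC1 : 0 < C1 := by rw [hC1def]; positivity
  obtain ⟨B, hBdef⟩ : ∃ B : ℝ, B = K * (1 / c ^ 2 + C1 ^ 2) + (1 + K ^ 2) * (C1 / c) := ⟨_, rfl⟩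
  have hB : 0 < B := by rw [hBdef]; positivity
  refine ⟨24 * B / dstar ^ 2, by positivity, ?_⟩
  intro n _ P hdiam hG1 hG2 x hx i j a b hij hab
  have hinj : Function.Injective P.v := by
    intro k l hkl
    by_contra hne
    have := hG2 k l hne
    rw [hkl, dist_self] at this
    linarith
  have hone := one_ne P.hn
  have htwo := two_ne P.hn
  have hsucc : ∀ k : Fin n, k + 1 ≠ k := fun k h => hone (by simpa using h)
  have hbd : Bornology.IsBounded P.region := (region_compact P).isBounded
  have hxr : x ∈ P.region := interior_subset hx
  have hr1 : ∀ z ∈ P.region, ‖z - x‖ ≤ 1 := by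
    intro z hz
    rw [← dist_eq_norm, ← hdiam]
    exact Metric.dist_le_diam_of_mem hbd hz hxr
  have hsupp : ∀ k : Fin n, ∃ ν h, Supp P x k ν h := fun k => exists_supp P hinj hx k (hsucc k)
  choose ν h hS using hsupp
  obtain ⟨c0, hc0⟩ := exists_ball hγ hdiam hG1 hx
  have hd1 : dstar ≤ 1 := by
    have h1 := hG2 0 1 hone.symm
    have h2 := Metric.dist_le_diam_of_mem hbd (v_mem P 0) (v_mem P 1)
    rw [hdiam] at h2
    linarith
  -- distances
  have hrdef : ∀ k, P.r k x = ‖P.v k - x‖ := fun k => by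
    unfold ConvexPolygon.r; rw [dist_comm, dist_eq_norm]
  have hrpos : ∀ k, 0 < P.r k x := fun k => by
    rw [hrdef]; exact norm_pos_iff.mpr (sub_ne_zero.mpr (hS k).left_ne)
  have hrle : ∀ k, P.r k x ≤ 1 := fun k => by rw [hrdef]; exact hr1 _ (v_mem P k)
  have htdef : ∀ k, P.t k x = Real.tan (∠ (P.v k) x (P.v (k + 1)) / 2) := fun k => rfl
  have ht0 : ∀ k, 0 ≤ P.t k x := fun k => by
    rw [htdef]
    have h1 : 0 ≤ ∠ (P.v k) x (P.v (k + 1)) := InnerProductGeometry.angle_nonneg _ _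
    have h2 := (hS k).angle_lt_pi
    exact Real.tan_nonneg_of_nonneg_of_le_pi_div_two (by linarith) (by linarith)
  -- weights
  set W := ∑ k : Fin n, P.w k x with hW
  have hw0 : ∀ k, 0 ≤ P.w k x := fun k => by
    unfold ConvexPolygon.w
    exact div_nonneg (add_nonneg (ht0 _) (ht0 _)) (hrpos k).le
  have hwW : ∀ k, P.w k x ≤ W := fun k =>
    Finset.single_le_sum (f := fun k => P.w k x) (fun k _ => hw0 k) (Finset.mem_univ k)
  have hW1 : ∀ k, P.t k x ≤ P.r k x * W := fun k => by
    have h1 := hwW k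
    unfold ConvexPolygon.w at h1
    rw [div_le_iff₀ (hrpos k)] at h1
    linarith [ht0 (k - 1)]
  have hW2 : ∀ k, P.t k x ≤ P.r (k + 1) x * W := fun k => by
    have h1 := hwW (k + 1)
    unfold ConvexPolygon.w at h1
    rw [div_le_iff₀ (hrpos _), add_sub_cancel_right] at h1
    linarith [ht0 (k + 1)]
  -- nearest vertex
  obtain ⟨m, -, hm⟩ := Finset.exists_min_image Finset.univ (fun k => P.r k x) ⟨i, Finset.mem_univ i⟩
  have hm' : ∀ k, P.r m x ≤ P.r k x := fun k => hm k (Finset.mem_univ k)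
  have hfar : ∀ k, k ≠ m → dstar / 2 ≤ P.r k x := fun k hk => by
    have h1 := hG2 k m hk
    have h2 := dist_triangle_left (P.v k) (P.v m) x
    have h3 := hm' k
    unfold ConvexPolygon.r at h3 ⊢
    linarith
  have hmm : m - 1 + 1 = m := sub_add_cancel m 1
  have hm1 : m - 1 ≠ m := fun hh => hsucc (m - 1) (by rw [hmm]; exact hh.symm)
  have hm2 : m - 1 ≠ m + 1 := fun hh => htwo (by
    have : m + (1 + 1) = m := by rw [← add_assoc, ← hh, hmm]
    simpa using this)
  have hW0 : 0 ≤ W := Finset.sum_nonneg (fun k _ => hw0 k)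
  have hcRW : c ≤ P.r m x * W := by
    rcases edge_dir (hS m) (hS (m - 1)) hmm hm1 hm2 (hsucc m) with hdir | hdir
    · have := tan_lower hd (hS m).angle_lt_pi (hS m).left_ne (hS (m + 1)).left_ne
        (hG2 m (m + 1) (hsucc m).symm).le (hrle m) (hm' (m + 1)) hdir
      have h2 : c ≤ P.t m x := by
        rw [hcdef]; exact (Real.sqrt_le_left (ht0 m)).mpr this
      exact h2.trans (hW1 m)
    · have hang : ∠ (P.v m) x (P.v (m - 1)) = ∠ (P.v (m - 1)) x (P.v (m - 1 + 1)) := by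
        rw [hmm, EuclideanGeometry.angle_comm]
      have hpi := (hS (m - 1)).angle_lt_pi
      rw [← hang] at hpi
      have := tan_lower hd hpi (hS m).left_ne (hS (m - 1)).left_ne
        (hG2 m (m - 1) hm1.symm).le (hrle m) (hm' (m - 1)) hdir
      rw [hang] at this
      have h2 : c ≤ P.t (m - 1) x := by
        rw [hcdef]; exact (Real.sqrt_le_left (ht0 (m - 1))).mpr this
      have h3 := hW2 (m - 1)
      rw [hmm] at h3
      exact h2.trans h3
  have hRW : 0 < P.r m x * W := by linarith
  have htC : ∀ k, P.t k x ≤ C1 * (P.r m x * W) := by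
    intro k
    have q1 : 0 ≤ K / c * (P.r m x * W) := by positivity
    have q2 : 0 ≤ 1 / δ * (P.r m x * W) := by positivity
    have q3 : C1 * (P.r m x * W) = P.r m x * W + K / c * (P.r m x * W) +
        1 / δ * (P.r m x * W) := by rw [hC1def]; ring
    rw [q3]
    by_cases k1 : m = k
    · have := hW1 k; rw [← k1] at this ⊢; linarith
    by_cases k2 : m = k + 1
    · have := hW2 k; rw [← k2] at this; linarith
    rcases lt_or_ge (P.r m x) δ with hR | hR
    · have htK : P.t k x ≤ K := by
        by_contra hcon
        push Not at hcon
        have f1 := hfar k (Ne.symm k1)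
        have f2 := hfar (k + 1) (Ne.symm k2)
        rw [hrdef] at f1 f2 hR
        rw [hδdef] at hR
        rw [hKdef] at hcon
        exact claimB (hS m) (hS k) k1 k2 hr1 (by positivity) hc0 hM hρM hd hd1 hR f1 f2 hcon.le
      have : K ≤ K / c * (P.r m x * W) := by
        rw [div_mul_eq_mul_div, le_div_iff₀ hc]; gcongr
      linarith
    · have s1 : P.t k x ≤ W := (hW1 k).trans (mul_le_of_le_one_left hW0 (hrle k))
      have s2 : W ≤ 1 / δ * (P.r m x * W) := by
        rw [one_div, inv_mul_eq_div, le_div_iff₀ hδ, mul_comm]; gcongr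
      linarith
  have hmin : P.t i x ≤ K ∨ P.t j x ≤ K := by
    by_contra hcon
    push Not at hcon
    obtain ⟨g1, g2⟩ := hcon
    rw [hKdef] at g1 g2
    exact claimA (hS i) (hS j) hij hr1 (by positivity) hc0 hM hρM g1.le g2.le
  have hfin := final_real (δ := δ) hc hK (ht0 i) (ht0 j) hC1 hcRW (htC i) (htC j) hmin
  rw [← hBdef] at hfin
  have hgrad := gradient_bound (P.v i) (P.v (i + 1)) x (hS i).left_ne (hS (i + 1)).left_ne
    (hS i).angle_lt_pi (hrle i) (hrle (i + 1))
  have hprod : ∀ k l : Fin n, k ≠ l → P.r m x * (dstar / 2) ≤ P.r k x * P.r l x := by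
    intro k l hkl
    by_cases hk : k = m
    · have : l ≠ m := fun hl => hkl (hk.trans hl.symm)
      exact mul_le_mul (hm' k) (hfar l this) (by positivity) (hrpos k).le
    · rw [mul_comm (P.r k x)]
      exact mul_le_mul (hm' l) (hfar k hk) (by positivity) (hrpos l).le
  have p1 := hprod i (i + 1) (hsucc i).symm
  have p2 := hprod a b hab
  have hR0 := hrpos m
  have hra := hrpos a
  have hrb := hrpos b
  have hri := hrpos i
  have hri1 := hrpos (i + 1)
  have hti := ht0 i
  have htj := ht0 j
  have hgrad' : ‖gradient (fun y : E2 => Real.tan (P.angleAt i y / 2)) x‖ ≤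
      6 * (1 + P.t i x ^ 2) / (P.r i x * P.r (i + 1) x) := hgrad
  calc ‖gradient (fun y : E2 => Real.tan (P.angleAt i y / 2)) x‖ * P.t j x /
              (P.r a x * P.r b x)
      ≤ (6 * (1 + P.t i x ^ 2) / (P.r m x * (dstar / 2))) * P.t j x / (P.r m x * (dstar / 2)) := by
        have hg2 : ‖gradient (fun y : E2 => Real.tan (P.angleAt i y / 2)) x‖ ≤
            6 * (1 + P.t i x ^ 2) / (P.r m x * (dstar / 2)) := by
          refine hgrad'.trans ?_
          gcongr
        gcongr
    _ = 24 / (dstar ^ 2 * P.r m x ^ 2) * ((1 + P.t i x ^ 2) * P.t j x) := by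
        field_simp; ring
    _ ≤ 24 / (dstar ^ 2 * P.r m x ^ 2) * (B * (P.r m x * W) ^ 2) := by gcongr
    _ = 24 * B / dstar ^ 2 * W ^ 2 := by field_simp
end
end

section
/- For all real numbers γ* > 0 and d_* > 0 there exists a constant C > 0 such that for every convex polygon Ω of diameter 1 satisfying G1 (γ < γ*) and G2 (|v_i − v_j| > d_* for all i ≠ j), every index i, and every x in the interior of Ω, the mean value coordinate λ_i is differentiable at x and ‖∇λ_i(x)‖ ≤ C. -/
open EuclideanGeometry Metric Real

noncomputable section

namespace MV
open ConvexPolygon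

def cr (s : ℝ) (a b : E2) : ℝ := s * (a 0 * b 1 - a 1 * b 0)
def ip (a b : E2) : ℝ := a 0 * b 0 + a 1 * b 1

lemma nsq (a : E2) : ‖a‖ ^ 2 = a 0 * a 0 + a 1 * a 1 := by
  rw [EuclideanSpace.norm_sq_eq]
  simp [Fin.sum_univ_two, sq]

lemma cr_ip_sq {s : ℝ} (hs : s ^ 2 = 1) (a b : E2) :
    cr s a b ^ 2 + ip a b ^ 2 = ‖a‖ ^ 2 * ‖b‖ ^ 2 := by
  rw [nsq, nsq]; unfold cr ip
  rw [mul_pow, hs]; ring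

lemma abs_cr_le {s : ℝ} (hs : s ^ 2 = 1) (a b : E2) : |cr s a b| ≤ ‖a‖ * ‖b‖ := by
  apply abs_le_of_sq_le_sq _ (by positivity)
  have := cr_ip_sq hs a b
  nlinarith [sq_nonneg (ip a b)]

lemma abs_ip_le (a b : E2) : |ip a b| ≤ ‖a‖ * ‖b‖ := by
  apply abs_le_of_sq_le_sq _ (by positivity)
  have := cr_ip_sq (s := 1) (by norm_num) a b
  nlinarith [sq_nonneg (cr 1 a b)]

lemma ext3 {S : Set E2} (hS : Convex ℝ S) {v A B C : E2} (hv : v ∈ Set.extremePoints ℝ S)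
    (hA : A ∈ S) (hB : B ∈ S) (hC : C ∈ S) {p q r : ℝ} (hp : 0 < p) (hq : 0 ≤ q) (hr : 0 ≤ r)
    (hsum : p + q + r = 1) (h : v = p • A + q • B + r • C) : A = v := by
  rcases eq_or_lt_of_le (add_nonneg hq hr) with h0 | h0
  · have hq0 : q = 0 := by linarith
    have hr0 : r = 0 := by linarith
    have hp1 : p = 1 := by linarith
    subst hq0 hr0 hp1
    simp at h
    exact h.symm
  · have hD : (q / (q + r)) • B + (r / (q + r)) • C ∈ S :=
      hS hB hC (by positivity) (by positivity) (by field_simp)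
    rw [mem_extremePoints] at hv
    refine (hv.2 A hA _ hD ⟨p, q + r, hp, h0, by linarith, ?_⟩).1
    rw [h, smul_add, smul_smul, smul_smul, mul_div_cancel₀ _ h0.ne', mul_div_cancel₀ _ h0.ne',
      add_assoc]

/-- `s` is a consistent orientation sign. -/
def Orient {n : ℕ} [NeZero n] (P : ConvexPolygon n) (s : ℝ) : Prop :=
  s ^ 2 = 1 ∧ ∀ i, (∀ y ∈ P.region, 0 ≤ cr s (P.v (i + 1) - P.v i) (y - P.v i)) ∧
    (∀ y ∈ interior P.region, 0 < cr s (P.v (i + 1) - P.v i) (y - P.v i))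

variable {n : ℕ} [NeZero n] (P : ConvexPolygon n)

lemma v_mem (i : Fin n) : P.v i ∈ P.region := subset_convexHull ℝ _ ⟨i, rfl⟩

lemma conv : Convex ℝ P.region := convex_convexHull ℝ _

lemma edge_sign (hne : (interior P.region).Nonempty) (i : Fin n) (hi : P.v (i + 1) ≠ P.v i) :
    ∃ s : ℝ, s ^ 2 = 1 ∧ (∀ y ∈ P.region, 0 ≤ cr s (P.v (i + 1) - P.v i) (y - P.v i)) ∧
    (∀ y ∈ interior P.region, 0 < cr s (P.v (i + 1) - P.v i) (y - P.v i)) := by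
  set a := P.v i with ha
  set b := P.v (i + 1) with hb
  set m : E2 := (1 / 2 : ℝ) • a + (1 / 2 : ℝ) • b with hm
  have hmf : m ∈ frontier P.region := by
    unfold ConvexPolygon.region
    rw [P.boundary]
    exact Set.mem_iUnion.2 ⟨i, 1 / 2, 1 / 2, by norm_num, by norm_num, by norm_num, rfl⟩
  have hmi : m ∉ interior P.region := fun h => by
    rw [frontier, Set.mem_sdiff] at hmf; exact hmf.2 h
  obtain ⟨f, hf⟩ := geometric_hahn_banach_open_point (conv P).interior isOpen_interior hmi
  have hcl : ∀ y ∈ P.region, f y ≤ f m := by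
    intro y hy
    have : y ∈ closure (interior P.region) := by
      rw [(conv P).closure_interior_eq_closure_of_nonempty_interior hne]
      exact subset_closure hy
    exact closure_minimal (t := {y | f y ≤ f m}) (fun z hz => (hf z hz).le)
      (isClosed_le f.continuous continuous_const) this
  -- coordinates of f
  set p := f (EuclideanSpace.single 0 1) with hp
  set q := f (EuclideanSpace.single 1 1) with hq
  have hfy : ∀ y : E2, f y = y 0 * p + y 1 * q := by
    intro y
    have : y = y 0 • EuclideanSpace.single 0 (1 : ℝ) + y 1 • EuclideanSpace.single 1 (1 : ℝ) := by
      ext j; fin_cases j <;> simp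
    conv_lhs => rw [this]
    rw [map_add, map_smul, map_smul]; simp [hp, hq]
  have hfa := hcl a (v_mem P i)
  have hfb := hcl b (v_mem P (i + 1))
  have hfm : f m = (f a + f b) / 2 := by
    rw [hm, map_add, map_smul, map_smul]; simp; ring
  have hab : f a = f b := by linarith
  have hma : f m = f a := by linarith
  rw [hfy a, hfy b] at hab
  -- p,q proportional to J w
  set w := b - a with hw
  have hw0 : w 0 * p + w 1 * q = 0 := by simp [hw]; linarith
  have hwn : 0 < w 0 * w 0 + w 1 * w 1 := by
    rw [← nsq]
    have : w ≠ 0 := sub_ne_zero.2 hi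
    positivity
  have key : ∀ y : E2, (w 0 * w 0 + w 1 * w 1) * (f y - f m) =
      (w 0 * q - w 1 * p) * cr 1 w (y - a) := by
    intro y
    rw [hma, hfy, hfy]
    simp only [cr, PiLp.sub_apply]
    linear_combination (w 0 * (y 0 - a 0) + w 1 * (y 1 - a 1)) * hw0
  have crs : ∀ (s : ℝ) (y z : E2), cr s y z = s * cr 1 y z := by intro s y z; simp [cr]
  obtain ⟨x, hx⟩ := hne
  have hκ : w 0 * q - w 1 * p ≠ 0 := by
    intro h0
    have := key x
    rw [h0, zero_mul] at this
    have h2 := hf x hx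
    nlinarith
  rcases lt_or_gt_of_ne hκ with h | h
  · refine ⟨1, by norm_num, fun y hy => ?_, fun y hy => ?_⟩
    · have := key y; have := hcl y hy
      by_contra hc; push Not at hc
      nlinarith [mul_pos_of_neg_of_neg h hc]
    · have := key y; have := hf y hy
      by_contra hc; push Not at hc
      nlinarith [mul_nonneg_of_nonpos_of_nonpos h.le hc]
  · refine ⟨-1, by norm_num, fun y hy => ?_, fun y hy => ?_⟩
    · rw [crs]
      have := key y; have := hcl y hy
      by_contra hc; push Not at hc
      nlinarith [mul_pos h (by linarith : 0 < cr 1 w (y - a))]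
    · rw [crs]
      have := key y; have := hf y hy
      by_contra hc; push Not at hc
      nlinarith [mul_nonneg h.le (by linarith : 0 ≤ cr 1 w (y - a))]

lemma fin_ne1 (hn : 3 ≤ n) (i : Fin n) : i + 1 ≠ i := by
  intro h
  have h1 : (1 : Fin n) = 0 := by simpa using h
  have := congrArg Fin.val h1
  rw [Fin.val_one' , Fin.val_zero, Nat.mod_eq_of_lt (by omega)] at this
  omega

lemma fin_ne2 (hn : 3 ≤ n) (i : Fin n) : i + 1 + 1 ≠ i := by
  intro h
  have h1 : (1 : Fin n) + 1 = 0 := by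
    rw [add_assoc] at h; simpa using h
  have := congrArg Fin.val h1
  rw [Fin.val_add, Fin.val_one' , Fin.val_zero, Nat.mod_eq_of_lt (a := 1) (by omega),
    Nat.mod_eq_of_lt (by omega)] at this
  omega

lemma exists_orient (hne : (interior P.region).Nonempty) (hinj : Function.Injective P.v) :
    ∃ s, Orient P s := by
  choose s hs using fun i => edge_sign P hne i (fun h => fin_ne1 P.hn i (hinj h))
  have hstep : ∀ i, s (i + 1) = s i := by
    intro i
    by_contra hneq
    obtain ⟨h1, h2, h3⟩ := hs i
    obtain ⟨h1', h2', h3'⟩ := hs (i + 1)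
    obtain ⟨x, hx⟩ := hne
    have hneg : s (i + 1) = - s i := by
      have : (s (i + 1) - s i) * (s (i + 1) + s i) = 0 := by linear_combination h1' - h1
      rcases mul_eq_zero.1 this with h | h
      · exact absurd (by linarith) hneq
      · linarith
    have A := h2 _ (v_mem P (i + 1 + 1))
    have B := h2' _ (v_mem P i)
    have Ax := h3 x hx
    have Bx := h3' x hx
    have e01 : P.v (i + 1) ≠ P.v i := fun h => fin_ne1 P.hn i (hinj h)
    have e12 : P.v (i + 1 + 1) ≠ P.v (i + 1) := fun h => fin_ne1 P.hn (i + 1) (hinj h)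
    have e02 : P.v (i + 1 + 1) ≠ P.v i := fun h => fin_ne2 P.hn i (hinj h)
    have E0 := P.extreme i
    have E2' := P.extreme (i + 1 + 1)
    have M0 := v_mem P i
    have M1 := v_mem P (i + 1)
    have M2 := v_mem P (i + 1 + 1)
    rw [hneg] at B Bx
    generalize P.v i = a at *
    generalize P.v (i + 1) = b at *
    generalize P.v (i + 1 + 1) = c at *
    generalize s i = σ at *
    -- d1 = a - b, d2 = c - b
    have Z : cr σ (a - b) (c - b) = 0 := by
      simp only [cr, PiLp.sub_apply] at *
      nlinarith
    have hσ : σ ≠ 0 := by rintro rfl; norm_num at h1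
    have Z' : (a 0 - b 0) * (c 1 - b 1) - (a 1 - b 1) * (c 0 - b 0) = 0 := by
      simp only [cr, PiLp.sub_apply] at Z
      exact (mul_eq_zero.1 Z).resolve_left hσ
    -- k1 = cr(d1,u) , k2 = cr(d2,u); k2 * d1 = k1 * d2
    set k1 := cr σ (b - a) (x - a) with hk1
    set k2 := cr (-σ) (c - b) (x - b) with hk2
    have l0 : k2 * (a 0 - b 0) = k1 * (c 0 - b 0) := by
      simp only [hk1, hk2, cr, PiLp.sub_apply]
      linear_combination (σ * (x 0 - b 0)) * Z'
    have l1 : k2 * (a 1 - b 1) = k1 * (c 1 - b 1) := by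
      simp only [hk1, hk2, cr, PiLp.sub_apply]
      linear_combination (σ * (x 1 - b 1)) * Z'
    rcases le_total k1 k2 with hle | hle
    · -- a between b and c
      have : c = a := by
        refine ext3 (conv P) (v := a) (A := c) (B := b) (C := b) E0 M2 M1 M1
          (p := k1 / k2) (q := 1 - k1 / k2) (r := 0) (by positivity)
          (by rw [sub_nonneg, div_le_one Bx]; exact hle) le_rfl (by ring) ?_
        ext j; fin_cases j
        · simp; field_simp; linarith
        · simp; field_simp; linarith
      exact e02 this
    · have : a = c := by
        refine ext3 (conv P) (v := c) (A := a) (B := b) (C := b) E2' M0 M1 M1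
          (p := k2 / k1) (q := 1 - k2 / k1) (r := 0) (by positivity)
          (by rw [sub_nonneg, div_le_one Ax]; exact hle) le_rfl (by ring) ?_
        ext j; fin_cases j
        · simp; field_simp; linarith
        · simp; field_simp; linarith
      exact e02 this.symm
  have hconst : ∀ i, s i = s 0 := by
    intro i
    have : ∀ k : ℕ, s (Fin.ofNat n k) = s 0 := by
      intro k
      induction k with
      | zero => congr 1
      | succ k ih =>
        rw [← ih, ← hstep (Fin.ofNat n k)]
        congr 1
        apply Fin.ext
        simp [Fin.val_add, Fin.ofNat]
    have h := this i.val
    rwa [Fin.ofNat_val_eq_self] at h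
  refine ⟨s 0, (hs 0).1, fun i => ?_⟩
  rw [← hconst i]
  exact (hs i).2

end MV

namespace MV
open ConvexPolygon

lemma cr_swap (s : ℝ) (a b : E2) : cr s b a = - cr s a b := by simp only [cr]; ring
lemma cr_self (s : ℝ) (a : E2) : cr s a a = 0 := by simp only [cr]; ring
lemma cr_smul (s p q : ℝ) (a b : E2) : cr s (p • a) (q • b) = p * q * cr s a b := by
  simp only [cr, PiLp.smul_apply, smul_eq_mul]; ring
lemma ip_smul (p q : ℝ) (a b : E2) : ip (p • a) (q • b) = p * q * ip a b := by
  simp only [ip, PiLp.smul_apply, smul_eq_mul]; ring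
lemma cr_add_left (s : ℝ) (a b c : E2) : cr s (a + b) c = cr s a c + cr s b c := by
  simp only [cr, PiLp.add_apply]; ring
lemma cr_add_right (s : ℝ) (a b c : E2) : cr s c (a + b) = cr s c a + cr s c b := by
  simp only [cr, PiLp.add_apply]; ring
lemma ip_comm (a b : E2) : ip a b = ip b a := by simp only [ip]; ring
lemma ip_self (a : E2) : ip a a = ‖a‖ ^ 2 := by rw [nsq]; rfl
lemma nsq_add (a b : E2) : ‖a + b‖ ^ 2 = ‖a‖ ^ 2 + ‖b‖ ^ 2 + 2 * ip a b := by
  simp only [nsq, ip, PiLp.add_apply]; ring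
lemma nsq_sub (a b : E2) : ‖a - b‖ ^ 2 = ‖a‖ ^ 2 + ‖b‖ ^ 2 - 2 * ip a b := by
  simp only [nsq, ip, PiLp.sub_apply]; ring

/-- `|w|² cr(p,q) = <w,p> cr(w,q) - cr(w,p) <w,q>` -/
lemma cr_expand (s : ℝ) (w p q : E2) :
    ‖w‖ ^ 2 * cr s p q = ip w p * cr s w q - cr s w p * ip w q := by
  simp only [nsq, cr, ip]; ring

lemma inner_eq_ip (a b : E2) : inner ℝ a b = ip a b := by
  simp [ip, PiLp.inner_apply, Fin.sum_univ_two, mul_comm]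

lemma tan_facts {s : ℝ} (hs : s ^ 2 = 1) {a b : E2} (h : 0 < cr s a b) :
    0 < ‖a‖ ∧ 0 < ‖b‖ ∧ 0 < ‖a‖ * ‖b‖ + ip a b ∧
    0 < tan (InnerProductGeometry.angle a b / 2) ∧
    tan (InnerProductGeometry.angle a b / 2) * (‖a‖ * ‖b‖ + ip a b) = cr s a b ∧
    tan (InnerProductGeometry.angle a b / 2) * cr s a b = ‖a‖ * ‖b‖ - ip a b := by
  have hsq := cr_ip_sq hs a b
  have ha : 0 < ‖a‖ := by
    rw [norm_pos_iff]; rintro rfl; simp [cr] at h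
  have hb : 0 < ‖b‖ := by
    rw [norm_pos_iff]; rintro rfl; simp [cr] at h
  have hab : 0 < ‖a‖ * ‖b‖ := mul_pos ha hb
  have hQ : 0 < ‖a‖ * ‖b‖ + ip a b := by
    have h1 : |ip a b| < ‖a‖ * ‖b‖ := by
      apply abs_lt_of_sq_lt_sq _ hab.le
      nlinarith [sq_pos_of_pos h]
    linarith [(abs_lt.1 h1).1]
  set θ := InnerProductGeometry.angle a b with hθ
  have hcos : cos θ * (‖a‖ * ‖b‖) = ip a b := by
    rw [hθ, InnerProductGeometry.cos_angle_mul_norm_mul_norm, inner_eq_ip]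
  have hsin : sin θ * (‖a‖ * ‖b‖) = cr s a b := by
    rw [hθ, InnerProductGeometry.sin_angle_mul_norm_mul_norm]
    simp only [inner_eq_ip, ip_self]
    rw [Real.sqrt_eq_iff_mul_self_eq_of_pos h]
    nlinarith
  have hc : 0 < cos (θ / 2) := by
    have h2 : cos θ = 2 * cos (θ / 2) ^ 2 - 1 := by
      rw [← Real.cos_two_mul]; congr 1; ring
    have h0 : 0 ≤ cos (θ / 2) := by
      apply Real.cos_nonneg_of_neg_pi_div_two_le_of_le
      · linarith [InnerProductGeometry.angle_nonneg a b, Real.pi_pos]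
      · linarith [InnerProductGeometry.angle_le_pi a b]
    rcases h0.eq_or_lt with h0 | h0
    · rw [← h0] at h2; rw [h2] at hcos; nlinarith
    · exact h0
  have h2 : cos θ = 2 * cos (θ / 2) ^ 2 - 1 := by
    rw [← Real.cos_two_mul]; congr 1; ring
  have h3 : sin θ = 2 * sin (θ / 2) * cos (θ / 2) := by
    rw [← Real.sin_two_mul]; congr 1; ring
  have ht : tan (θ / 2) * (‖a‖ * ‖b‖ + ip a b) = cr s a b := by
    rw [← hcos, ← hsin, Real.tan_eq_sin_div_cos, h2, h3]; field_simp; ring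
  have htp : 0 < tan (θ / 2) := by
    by_contra hcon; push Not at hcon
    nlinarith
  refine ⟨ha, hb, hQ, htp, ht, ?_⟩
  have : (‖a‖ * ‖b‖ + ip a b) * (tan (θ / 2) * cr s a b)
      = (‖a‖ * ‖b‖ + ip a b) * (‖a‖ * ‖b‖ - ip a b) := by
    calc _ = (tan (θ / 2) * (‖a‖ * ‖b‖ + ip a b)) * cr s a b := by ring
      _ = _ := by rw [ht]; linear_combination hsq
  exact mul_left_cancel₀ hQ.ne' this

variable {n : ℕ} [NeZero n] (P : ConvexPolygon n)

lemma r_eq (i : Fin n) (x : E2) : P.r i x = ‖P.v i - x‖ := by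
  unfold ConvexPolygon.r; rw [dist_comm, dist_eq_norm]

lemma t_eq (i : Fin n) (x : E2) :
    P.t i x = tan (InnerProductGeometry.angle (P.v i - x) (P.v (i + 1) - x) / 2) := rfl

lemma area_eq (s : ℝ) (i : Fin n) (x : E2) :
    cr s (P.v i - x) (P.v (i + 1) - x) = cr s (P.v (i + 1) - P.v i) (x - P.v i) := by
  simp only [cr, PiLp.sub_apply]; ring

lemma area_pos {s : ℝ} (hO : Orient P s) {x : E2} (hx : x ∈ interior P.region) (i : Fin n) :
    0 < cr s (P.v i - x) (P.v (i + 1) - x) := by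
  rw [area_eq]; exact (hO.2 i).2 x hx

/-- all per-edge facts -/
lemma edge_facts {s : ℝ} (hO : Orient P s) {x : E2} (hx : x ∈ interior P.region) (i : Fin n) :
    0 < P.r i x ∧ 0 < P.r (i + 1) x ∧ 0 < P.r i x * P.r (i + 1) x + ip (P.v i - x) (P.v (i + 1) - x) ∧
    0 < P.t i x ∧
    P.t i x * (P.r i x * P.r (i + 1) x + ip (P.v i - x) (P.v (i + 1) - x)) =
      cr s (P.v i - x) (P.v (i + 1) - x) ∧
    P.t i x * cr s (P.v i - x) (P.v (i + 1) - x) =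
      P.r i x * P.r (i + 1) x - ip (P.v i - x) (P.v (i + 1) - x) := by
  simp only [r_eq, t_eq]
  exact tan_facts hO.1 (area_pos P hO hx i)

lemma sector {s : ℝ} (hO : Orient P s) {x : E2} (hx : x ∈ interior P.region) (i m : Fin n)
    (h1 : 0 < cr s (P.v i - x) (P.v m - x)) (h2 : 0 < cr s (P.v m - x) (P.v (i + 1) - x)) :
    False := by
  have hA := area_pos P hO hx i
  have hsup := (hO.2 i).1 _ (v_mem P m)
  have E := P.extreme m
  have M := v_mem P m
  have Mi := v_mem P i
  have Mi1 := v_mem P (i + 1)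
  have hx' := interior_subset hx
  generalize P.v m = y at *
  generalize P.v i = a at *
  generalize P.v (i + 1) = b at *
  set A := cr s (a - x) (b - x) with hAd
  set p := cr s (y - x) (b - x) with hp
  set q := cr s (a - x) (y - x) with hq
  have hpq : p + q ≤ A := by
    have : cr s (b - a) (y - a) = A - p - q := by
      simp only [hAd, hp, hq, cr, PiLp.sub_apply]; ring
    linarith
  have : a = y := by
    refine ext3 (conv P) (v := y) (A := a) (B := b) (C := x) E Mi Mi1 hx'
          (p := p / A) (q := q / A) (r := 1 - p / A - q / A) (by positivity)
          (by positivity) ?_ (by ring) ?_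
    · rw [sub_sub, ← add_div, sub_nonneg, div_le_one hA]; exact hpq
    · have e0 : A * (y 0 - x 0) = p * (a 0 - x 0) + q * (b 0 - x 0) := by
        simp only [hAd, hp, hq, cr, PiLp.sub_apply]; ring
      have e1 : A * (y 1 - x 1) = p * (a 1 - x 1) + q * (b 1 - x 1) := by
        simp only [hAd, hp, hq, cr, PiLp.sub_apply]; ring
      ext j; fin_cases j
      · simp; field_simp; linarith
      · simp; field_simp; linarith
  rw [this, cr_self] at hq
  linarith

lemma ray {x : E2} (hx : x ∈ interior P.region) {s : ℝ} (hO : Orient P s) (hinj : Function.Injective P.v)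
    (k j : Fin n) (hkj : k ≠ j) (hc : cr s (P.v k - x) (P.v j - x) = 0) :
    ip (P.v k - x) (P.v j - x) ≤ 0 := by
  by_contra hip; push Not at hip
  obtain ⟨hk, -⟩ := edge_facts P hO hx k
  obtain ⟨hj, -⟩ := edge_facts P hO hx j
  rw [r_eq] at hk hj
  have hne : P.v k ≠ P.v j := fun h => hkj (hinj h)
  have Ek := P.extreme k
  have Ej := P.extreme j
  have Mk := v_mem P k
  have Mj := v_mem P j
  have hx' := interior_subset hx
  generalize P.v k = a at *
  generalize P.v j = b at *
  have hs : s ≠ 0 := by rintro rfl; have := hO.1; norm_num at this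
  have hc' : (a 0 - x 0) * (b 1 - x 1) - (a 1 - x 1) * (b 0 - x 0) = 0 := by
    simp only [cr, PiLp.sub_apply] at hc
    exact (mul_eq_zero.1 hc).resolve_left hs
  set K := ip (a - x) (b - x) with hK
  have aux : ∀ a b : E2, (a 0 - x 0) * (b 1 - x 1) - (a 1 - x 1) * (b 0 - x 0) = 0 →
      0 < ip (a - x) (b - x) → 0 < ‖a - x‖ ^ 2 → ip (a - x) (b - x) ≤ ‖a - x‖ ^ 2 →
      a ∈ P.region → b ∈ Set.extremePoints ℝ P.region → a = b := by
    intro a b hc' hK h0 hle Ma Eb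
    refine ext3 (conv P) (v := b) (A := a) (B := x) (C := x) Eb Ma hx' hx'
          (p := ip (a - x) (b - x) / ‖a - x‖ ^ 2) (q := 1 - ip (a - x) (b - x) / ‖a - x‖ ^ 2)
          (r := 0) (by positivity)
          (by rw [sub_nonneg, div_le_one h0]; exact hle) le_rfl (by ring) ?_
    have hn := nsq (a - x)
    have hi : ip (a - x) (b - x) = (a 0 - x 0) * (b 0 - x 0) + (a 1 - x 1) * (b 1 - x 1) := by
      simp [ip]
    simp only [PiLp.sub_apply] at hn
    set N := ‖a - x‖ ^ 2
    set I := ip (a - x) (b - x)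
    ext j; fin_cases j
    · simp; field_simp; rw [hn, hi]; linear_combination (-(a 1 - x 1)) * hc'
    · simp; field_simp; rw [hn, hi]; linear_combination ((a 0 - x 0)) * hc'
  rcases le_total ‖a - x‖ ‖b - x‖ with hle | hle
  · refine hne.symm (aux b a (by linarith) (by rwa [ip_comm]) (by positivity) ?_ Mj Ek)
    have := abs_ip_le (b - x) (a - x)
    nlinarith [le_abs_self (ip (b - x) (a - x))]
  · refine hne (aux a b (by linarith) hip (by positivity) ?_ Mk Ej)
    have := abs_ip_le (a - x) (b - x)
    nlinarith [le_abs_self (ip (a - x) (b - x))]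

/-- the ball is far from every edge line -/
lemma ball_edge {s : ℝ} (hO : Orient P s) {c : E2} {R : ℝ} (hR : 0 < R)
    (hb : closedBall c R ⊆ P.region) (i : Fin n) (hne : P.v (i + 1) ≠ P.v i) :
    dist (P.v (i + 1)) (P.v i) * R ≤ cr s (P.v (i + 1) - P.v i) (c - P.v i) := by
  rw [dist_eq_norm]
  set w := P.v (i + 1) - P.v i with hw
  have hL : 0 < ‖w‖ := norm_pos_iff.2 (sub_ne_zero.2 hne)
  set J : E2 := !₂[-w 1, w 0] with hJ
  have hJ0 : J 0 = - w 1 := by simp [hJ]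
  have hJ1 : J 1 = w 0 := by simp [hJ]
  have hJn : ‖J‖ = ‖w‖ := by
    have : ‖J‖ ^ 2 = ‖w‖ ^ 2 := by rw [nsq, nsq, hJ0, hJ1]; ring
    exact (pow_left_inj₀ (norm_nonneg _) (norm_nonneg _) two_ne_zero).1 this
  have habs : |s| = 1 := by
    exact (pow_eq_one_iff_of_nonneg (abs_nonneg s) two_ne_zero).1 (by rw [sq_abs]; exact hO.1)
  have hy : c - (s * R / ‖w‖) • J ∈ P.region := by
    apply hb
    rw [mem_closedBall, dist_eq_norm]
    simp only [sub_sub_cancel_left, norm_neg, norm_smul, hJn, Real.norm_eq_abs, abs_div, abs_mul,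
      habs, abs_of_pos hR, abs_of_pos hL]
    field_simp
    exact le_rfl
  have := (hO.2 i).1 _ hy
  have e : cr s w (c - (s * R / ‖w‖) • J - P.v i) =
      cr s w (c - P.v i) - ‖w‖ * R := by
    have hn := nsq w
    have h1 : cr s w (c - (s * R / ‖w‖) • J - P.v i) = cr s w (c - P.v i) -
        s ^ 2 * R / ‖w‖ * (w 0 * w 0 + w 1 * w 1) := by
      simp only [cr, PiLp.sub_apply, PiLp.smul_apply, smul_eq_mul, hJ0, hJ1]; ring
    rw [h1, ← hn, hO.1]; field_simp
  rw [e] at this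
  linarith

end MV

namespace MV
open ConvexPolygon

variable {n : ℕ} [NeZero n] (P : ConvexPolygon n)

lemma ball_dir {s : ℝ} (hs : s ^ 2 = 1) {c x u : E2} {R B : ℝ} (hR : 0 < R)
    (hb : closedBall c R ⊆ P.region) (hu : ‖u‖ = 1)
    (hB : ∀ m, cr s u (P.v m - x) ≤ B) : cr s u (c - x) + R ≤ B := by
  have hreg : ∀ y ∈ P.region, cr s u (y - x) ≤ B := by
    intro y hy
    refine convexHull_min (t := {y | cr s u (y - x) ≤ B}) ?_ ?_ hy
    · rintro _ ⟨m, rfl⟩; exact hB m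
    · intro y hy z hz a b ha hb hab
      simp only [Set.mem_ofPred_eq] at *
      have : cr s u (a • y + b • z - x) = a * cr s u (y - x) + b * cr s u (z - x) := by
        have hb' : b = 1 - a := by linarith
        subst hb'
        simp only [cr, PiLp.sub_apply, PiLp.add_apply, PiLp.smul_apply, smul_eq_mul]; ring
      rw [this]
      have : B = a * B + b * B := by rw [← add_mul, hab, one_mul]
      rw [this]
      gcongr
  set J : E2 := !₂[-u 1, u 0] with hJ
  have hJ0 : J 0 = - u 1 := by simp [hJ]
  have hJ1 : J 1 = u 0 := by simp [hJ]
  have hJn : ‖J‖ = 1 := by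
    have : ‖J‖ ^ 2 = ‖u‖ ^ 2 := by rw [nsq, nsq, hJ0, hJ1]; ring
    rw [← hu]
    exact (pow_left_inj₀ (norm_nonneg _) (norm_nonneg _) two_ne_zero).1 this
  have habs : |s| = 1 :=
    (pow_eq_one_iff_of_nonneg (abs_nonneg s) two_ne_zero).1 (by rw [sq_abs]; exact hs)
  have hy : c + (s * R) • J ∈ P.region := by
    apply hb
    rw [mem_closedBall, dist_eq_norm]
    simp [norm_smul, hJn, habs, abs_of_pos hR]
  have h := hreg _ hy
  have h1 : cr s u (c + (s * R) • J - x) = cr s u (c - x) + s ^ 2 * R * (u 0 * u 0 + u 1 * u 1) := by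
    simp only [cr, PiLp.sub_apply, PiLp.add_apply, PiLp.smul_apply, smul_eq_mul, hJ0, hJ1]; ring
  rw [h1, ← nsq, hs, hu] at h
  linarith

/-- At most one `t` is large. -/
lemma one_large {s : ℝ} (hO : Orient P s) {x : E2} (hx : x ∈ interior P.region)
    (hinj : Function.Injective P.v)
    (hr1 : ∀ m, P.r m x ≤ 1) {c : E2} {R : ℝ} (hR : 0 < R) (hR1 : R ≤ 1)
    (hb : closedBall c R ⊆ P.region) (hcx : dist c x ≤ 1) (k j : Fin n) (hkj : k ≠ j)
    (hk : 16 / R ≤ P.t k x) (hj : 16 / R ≤ P.t j x) : False := by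
  have hs := hO.1
  have rpos : ∀ i, 0 < P.r i x := fun i => (edge_facts P hO hx i).1
  set e : Fin n → E2 := fun i => (P.r i x)⁻¹ • (P.v i - x) with he
  have hen : ∀ i, ‖e i‖ = 1 := by
    intro i
    simp only [he, norm_smul, norm_inv, ← r_eq, Real.norm_eq_abs, abs_of_pos (rpos i)]
    exact inv_mul_cancel₀ (rpos i).ne'
  have hcr : ∀ i m, cr s (P.v i - x) (P.v m - x) = P.r i x * P.r m x * cr s (e i) (e m) := by
    intro i m
    simp only [he, cr_smul]
    have := (rpos i).ne'; have := (rpos m).ne'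
    field_simp
  have hip : ∀ i m, ip (P.v i - x) (P.v m - x) = P.r i x * P.r m x * ip (e i) (e m) := by
    intro i m
    simp only [he, ip_smul]
    have := (rpos i).ne'; have := (rpos m).ne'
    field_simp
  have hcr1 : ∀ i, 0 < cr s (e i) (e (i + 1)) := by
    intro i
    have := area_pos P hO hx i
    rw [hcr] at this
    exact pos_of_mul_pos_right this (mul_pos (rpos _) (rpos _)).le
  have hsec : ∀ i m, 0 < cr s (e i) (e m) → cr s (e m) (e (i + 1)) ≤ 0 := by
    intro i m h
    by_contra h2; push Not at h2
    refine sector P hO hx i m ?_ ?_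
    · rw [hcr]; have := rpos i; have := rpos m; positivity
    · rw [hcr]; have := rpos (i + 1); have := rpos m; positivity
  set ε := R / 8 with hε
  have hsmall : ∀ i, 16 / R ≤ P.t i x → ‖e i + e (i + 1)‖ ≤ ε ∧ ip (e i) (e (i + 1)) < 0 := by
    intro i hi
    obtain ⟨h1, h2, h3, h4, h5, h6⟩ := edge_facts P hO hx i
    rw [← h5, hip] at h6
    set t := P.t i x
    have h7 : t * t * (1 + ip (e i) (e (i + 1))) = 1 - ip (e i) (e (i + 1)) := by
      have hpos := mul_pos h1 h2
      apply mul_left_cancel₀ hpos.ne'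
      linear_combination h6
    have hsq : ‖e i + e (i + 1)‖ ^ 2 = 2 + 2 * ip (e i) (e (i + 1)) := by
      rw [nsq_add, hen, hen]; ring
    have ht16 : 16 ≤ t := by
      refine le_trans ?_ hi
      rw [le_div_iff₀ hR]; linarith
    have hRt : 16 ≤ t * R := by rwa [div_le_iff₀ hR] at hi
    set I := ip (e i) (e (i + 1))
    have hI0 : 0 ≤ 1 + I := by nlinarith [sq_nonneg ‖e i + e (i + 1)‖]
    refine ⟨?_, ?_⟩
    · apply le_of_sq_le_sq _ (by positivity)
      rw [hsq, hε]
      -- t^2 (1+I) = 2 - (1+I) ≤ 2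
      have a1 : t * t * (1 + I) ≤ 2 := by linarith
      have a2 : 256 ≤ (t * R) * (t * R) := by nlinarith
      have a3 : 256 * (1 + I) ≤ (t * R) * (t * R) * (1 + I) := by gcongr
      nlinarith
    · nlinarith
  obtain ⟨hk1, hk2⟩ := hsmall k hk
  obtain ⟨hj1, hj2⟩ := hsmall j hj
  have far : ∀ i, ‖e i + e (i + 1)‖ ≤ ε → ∀ m, cr s (e i) (e m) ≤ ε := by
    intro i hi m
    rcases le_or_gt (cr s (e i) (e m)) 0 with h | h
    · have : 0 ≤ ε := by positivity
      linarith
    · have h1 := hsec i m h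
      have h2 := cr_add_right s (e i) (e (i + 1)) (e m)
      have h3 := abs_cr_le hs (e m) (e i + e (i + 1))
      rw [hen, one_mul] at h3
      have h4 := cr_swap s (e m) (e i)
      linarith [(abs_le.1 (h3.trans hi)).1]
  have fark := far k hk1
  have farj := far j hj1
  have u1 := fark j
  have u2 : -(2 * ε) ≤ cr s (e k) (e j) := by
    have h1 := fark (j + 1)
    have h2 := cr_add_right s (e j) (e (j + 1)) (e k)
    have h3 := abs_cr_le hs (e k) (e j + e (j + 1))
    rw [hen, one_mul] at h3
    linarith [(abs_le.1 (h3.trans hj1)).1]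
  have hε8 : ε ≤ 1 / 8 := by rw [hε]; linarith
  have hεp : 0 < ε := by positivity
  have hci := cr_ip_sq hs (e k) (e j)
  rw [hen, hen] at hci
  have hcsq : cr s (e k) (e j) ^ 2 ≤ (2 * ε) ^ 2 := by
    apply sq_le_sq'
    · linarith
    · linarith
  rcases le_or_gt (ip (e k) (e j)) 0 with hneg | hpos
  · -- opposite directions
    have hsum : ‖e k + e j‖ ≤ 3 * ε := by
      apply le_of_sq_le_sq _ (by positivity)
      rw [nsq_add, hen, hen]
      have := cr_ip_sq hs (e k) (e j)
      have hI1 : -1 ≤ ip (e k) (e j) := by nlinarith [sq_nonneg (cr s (e k) (e j))]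
      nlinarith
    have vk := ball_dir P hs (c := c) (x := x) (u := e k) (B := ε) hR hb (hen k) ?_
    have vj := ball_dir P hs (c := c) (x := x) (u := e j) (B := ε) hR hb (hen j) ?_
    · have h2 := cr_add_left s (e k) (e j) (c - x)
      have h3 := abs_cr_le hs (e k + e j) (c - x)
      rw [← dist_eq_norm c x] at h3
      have h4 : ‖e k + e j‖ * dist c x ≤ 3 * ε * 1 := by gcongr
      have h5 := (abs_le.1 (h3.trans h4)).1
      linarith
    · intro m
      have : P.v m - x = P.r m x • e m := by
        simp only [he, smul_smul, mul_inv_cancel₀ (rpos m).ne', one_smul]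
      rw [this, ← one_smul ℝ (e j), cr_smul, one_mul]
      nlinarith [farj m, hr1 m, rpos m]
    · intro m
      have : P.v m - x = P.r m x • e m := by
        simp only [he, smul_smul, mul_inv_cancel₀ (rpos m).ne', one_smul]
      rw [this, ← one_smul ℝ (e k), cr_smul, one_mul]
      nlinarith [fark m, hr1 m, rpos m]
  · have claim : ∀ k j, ip (e k) (e (k + 1)) < 0 → 0 < ip (e k) (e j) → cr s (e k) (e j) ≤ 0 := by
      intro k j hk2 hpos
      by_contra h; push Not at h
      have h1 := hsec k j h
      have h2 := cr_expand s (e k) (e j) (e (k + 1))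
      rw [hen] at h2
      nlinarith [mul_pos hpos (hcr1 k), mul_pos h (neg_pos.2 hk2)]
    have c1 := claim k j hk2 hpos
    have c2 := claim j k hj2 (by rwa [ip_comm])
    rw [cr_swap s (e k) (e j)] at c2
    have c0 : cr s (e k) (e j) = 0 := by linarith
    have := ray P hx hO hinj k j hkj (by rw [hcr, c0, mul_zero])
    rw [hip] at this
    have : 0 < P.r k x * P.r j x * ip (e k) (e j) := by
      have := rpos k; have := rpos j; positivity
    linarith

set_option maxHeartbeats 1000000 in
/-- near a vertex one of the two angles is not small -/
lemma near_vertex {s : ℝ} (hO : Orient P s) {x : E2} (hx : x ∈ interior P.region)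
    (hinj : Function.Injective P.v) {d : ℝ} (hd : 0 < d) (o p q : Fin n) (hop : o + 1 = p)
    (hpq : p + 1 = q) (ho : d / 2 ≤ P.r o x) (hq : d / 2 ≤ P.r q x)
    (hp : P.r p x ≤ 3 / 10 * d) (h1 : P.t o x ≤ 1 / 2) (h2 : P.t p x ≤ 1 / 2) : False := by
  obtain ⟨a1, a2, a3, a4, a5, a6⟩ := edge_facts P hO hx o
  obtain ⟨b1, b2, b3, b4, b5, b6⟩ := edge_facts P hO hx p
  rw [hop] at a2 a3 a5 a6
  rw [hpq] at b2 b3 b5 b6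
  have hA := area_pos P hO hx o
  have hB := area_pos P hO hx p
  rw [hop] at hA
  rw [hpq] at hB
  have hne : P.v o ≠ P.v p := fun h => by
    have := hinj h; rw [← hop] at this; exact fin_ne1 P.hn o this.symm
  have E := P.extreme p
  have Mo := v_mem P o
  have Mq := v_mem P q
  have hx' := interior_subset hx
  -- cos ≥ 3/5
  have ca : 3 / 5 * (P.r o x * P.r p x) ≤ ip (P.v p - x) (P.v o - x) := by
    rw [ip_comm]
    rw [← a5] at a6
    have := mul_pos a1 a2
    have ht : P.t o x * P.t o x ≤ 1 / 4 := by nlinarith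
    nlinarith
  have cb : 3 / 5 * (P.r p x * P.r q x) ≤ ip (P.v p - x) (P.v q - x) := by
    rw [← b5] at b6
    have := mul_pos b1 b2
    have ht : P.t p x * P.t p x ≤ 1 / 4 := by nlinarith
    nlinarith
  have hexp := cr_expand s (P.v p - x) (P.v o - x) (P.v q - x)
  rw [cr_swap s (P.v o - x) (P.v p - x), ← r_eq] at hexp
  have hnp : ip (P.v p - x) (P.v p - x) = P.r p x ^ 2 := by rw [ip_self, r_eq]
  set A := cr s (P.v o - x) (P.v p - x) with hAd
  set B := cr s (P.v p - x) (P.v q - x) with hBd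
  set S := cr s (P.v o - x) (P.v q - x) with hSd
  set ro := P.r o x
  set rp := P.r p x
  set rq := P.r q x
  have hIo : 0 < ip (P.v p - x) (P.v o - x) := by have := mul_pos a1 a2; linarith
  have hIq : 0 < ip (P.v p - x) (P.v q - x) := by have := mul_pos b1 b2; linarith
  have hS : 0 < S := by
    have : 0 < rp ^ 2 * S := by rw [hexp]; nlinarith [mul_pos hIo hB, mul_pos hIq hA]
    exact pos_of_mul_pos_right this (by positivity)
  -- S * (v p - x) = B (v o - x) + A (v q - x)
  have e0 : S * (P.v p 0 - x 0) = B * (P.v o 0 - x 0) + A * (P.v q 0 - x 0) := by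
    simp only [hAd, hBd, hSd, cr, PiLp.sub_apply]; ring
  have e1 : S * (P.v p 1 - x 1) = B * (P.v o 1 - x 1) + A * (P.v q 1 - x 1) := by
    simp only [hAd, hBd, hSd, cr, PiLp.sub_apply]; ring
  have hdot : S * rp ^ 2 = B * ip (P.v p - x) (P.v o - x) + A * ip (P.v p - x) (P.v q - x) := by
    rw [← hnp]; simp only [ip, PiLp.sub_apply]
    linear_combination (P.v p 0 - x 0) * e0 + (P.v p 1 - x 1) * e1
  have hle : A + B ≤ S := by
    have g1 : 3 / 10 * d * rp ≤ ip (P.v p - x) (P.v o - x) := by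
      nlinarith [mul_le_mul_of_nonneg_right ho a2.le]
    have g2 : 3 / 10 * d * rp ≤ ip (P.v p - x) (P.v q - x) := by
      nlinarith [mul_le_mul_of_nonneg_right hq a2.le]
    have g3 : (A + B) * (3 / 10 * d * rp) ≤ S * rp ^ 2 := by
      rw [hdot]; nlinarith [mul_le_mul_of_nonneg_left g1 hB.le, mul_le_mul_of_nonneg_left g2 hA.le]
    have g4 : S * rp ^ 2 ≤ S * (3 / 10 * d * rp) := by
      have : rp ^ 2 ≤ 3 / 10 * d * rp := by rw [sq]; gcongr
      gcongr
    have g5 : 0 < 3 / 10 * d * rp := by positivity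
    exact le_of_mul_le_mul_right (g3.trans g4) g5
  apply hne
  refine ext3 (conv P) (v := P.v p) (A := P.v o) (B := P.v q) (C := x) E Mo Mq hx'
          (p := B / S) (q := A / S) (r := 1 - B / S - A / S) (by positivity)
          (by positivity) ?_ (by ring) ?_
  · rw [sub_sub, ← add_div, sub_nonneg, div_le_one hS]; linarith
  · ext j; fin_cases j
    · simp; field_simp; linarith
    · simp; field_simp; linarith

end MV

namespace MV
open ConvexPolygon

variable {n : ℕ} [NeZero n] (P : ConvexPolygon n)

set_option maxHeartbeats 1000000 in
/-- `x` cannot be near an edge `k` and a vertex `p` not on it. -/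
lemma edge_vertex {s : ℝ} (hO : Orient P s) {x : E2} (hx : x ∈ interior P.region)
    (hinj : Function.Injective P.v) {d : ℝ} (hd : 0 < d) (hd1 : d ≤ 1)
    (hdist : ∀ i j : Fin n, i ≠ j → d < dist (P.v i) (P.v j))
    (hr1 : ∀ m, P.r m x ≤ 1) (hL1 : ∀ i j, dist (P.v i) (P.v j) ≤ 1)
    {c : E2} {R : ℝ} (hR : 0 < R) (hR1 : R ≤ 1)
    (hb : closedBall c R ⊆ P.region) (hcv : ∀ m, dist c (P.v m) ≤ 1) (k l p : Fin n)
    (hkl : k + 1 = l) (hpk : p ≠ k) (hpl : p ≠ l)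
    (hp : P.r p x ≤ d ^ 2 * R / 16) (ht : 32 / (d ^ 3 * R) ≤ P.t k x) : False := by
  have hs := hO.1
  have hkl' : l ≠ k := by rw [← hkl]; exact fin_ne1 P.hn k
  obtain ⟨a1, a2, a3, a4, a5, a6⟩ := edge_facts P hO hx k
  have hball := ball_edge P hO hR hb k (by rw [hkl]; exact fun h => hkl' (hinj h))
  have hη0 := (hO.2 k).1 _ (v_mem P p)
  have hAx := area_eq P s k x
  rw [hkl] at a2 a3 a5 a6 hball hη0 hAx
  have hrl : d - P.r p x ≤ P.r l x := by
    have := hdist p l hpl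
    have h2 := dist_triangle (P.v p) x (P.v l)
    have e1 : dist (P.v p) x = P.r p x := by rw [dist_comm]; rfl
    have e2 : dist x (P.v l) = P.r l x := rfl
    linarith
  have hrk : d - P.r p x ≤ P.r k x := by
    have := hdist p k hpk
    have h2 := dist_triangle (P.v p) x (P.v k)
    have e1 : dist (P.v p) x = P.r p x := by rw [dist_comm]; rfl
    have e2 : dist x (P.v k) = P.r k x := rfl
    linarith
  have hLd := hdist l k hkl'
  have hL1' := hL1 l k
  rw [dist_eq_norm] at hLd hL1' hball
  have hcz := hcv p
  rw [dist_eq_norm] at hcz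
  have E := P.extreme p
  have Mk := v_mem P k
  have Ml := v_mem P l
  have Mc : c ∈ P.region := hb (mem_closedBall_self hR.le)
  have hrlk := hr1 k
  have hrll := hr1 l
  have nak : P.v k ≠ P.v p := fun h => hpk (hinj h).symm
  have nzk : ‖P.v p - x‖ = P.r p x := (r_eq P p x).symm
  have nk : ‖P.v k - x‖ = P.r k x := (r_eq P k x).symm
  have nl : ‖P.v l - x‖ = P.r l x := (r_eq P l x).symm
  have rp0 : 0 ≤ P.r p x := dist_nonneg
  generalize P.v k = a at *
  generalize P.v l = b at *
  generalize P.v p = z at *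
  generalize P.r k x = ra at *
  generalize P.r l x = rb at *
  generalize P.r p x = rz at *
  generalize P.t k x = t at *
  set w := b - a with hw
  set L := ‖w‖ with hL
  have hLpos : 0 < L := by linarith
  set η := cr s w (z - a) with hη
  have hd2 : d ^ 2 ≤ d := by nlinarith
  have hrz1 : rz ≤ d ^ 2 / 16 := by
    refine hp.trans ?_
    have : d ^ 2 * R ≤ d ^ 2 := by nlinarith [sq_nonneg d]
    linarith
  have ht1 : 1 ≤ t := by
    refine le_trans ?_ ht
    rw [le_div_iff₀ (by positivity)]
    have : d ^ 3 * R ≤ 1 * 1 := by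
      gcongr
      exact pow_le_one₀ hd.le hd1
    linarith
  have htm : 32 ≤ t * (d ^ 3 * R) := by rwa [div_le_iff₀ (by positivity)] at ht
  -- D ≤ 0
  have hD : ip (a - x) (b - x) ≤ 0 := by
    rw [← a5] at a6
    nlinarith [mul_pos a1 a2, mul_le_mul ht1 ht1 zero_le_one (by linarith)]
  -- area
  have hAle : cr s (a - x) (b - x) ≤ d ^ 3 * R / 16 := by
    have h1 : t * cr s (a - x) (b - x) ≤ 2 := by
      rw [a6]
      have := abs_ip_le (a - x) (b - x)
      rw [nk, nl] at this
      have h2 := (abs_le.1 this).1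
      have h3 : ra * rb ≤ 1 * 1 := by gcongr
      linarith
    have h4 : t * cr s (a - x) (b - x) ≤ t * (d ^ 3 * R / 16) := by linarith
    exact le_of_mul_le_mul_left h4 (by linarith)
  have hηle : η ≤ L * (d ^ 2 * R / 8) := by
    have h1 : η = cr s (a - x) (b - x) + cr s w (z - x) := by
      simp only [hη, hw, cr, PiLp.sub_apply]; ring
    have h2 := (abs_le.1 (abs_cr_le hs w (z - x))).2
    rw [nzk, ← hL] at h2
    have h3 : d ^ 3 * R / 16 ≤ L * (d ^ 2 * R / 16) := by
      have : d * (d ^ 2 * R / 16) ≤ L * (d ^ 2 * R / 16) := by gcongr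
      linarith [this]
    have h4 : L * rz ≤ L * (d ^ 2 * R / 16) := by gcongr
    rw [h1]; linarith
  have hrz_abs := abs_ip_le w (z - x)
  rw [nzk, ← hL] at hrz_abs
  have hrz2 : L * rz ≤ d ^ 2 / 16 := (mul_le_of_le_one_left rp0 hL1').trans hrz1
  have hrb : 3 / 4 * d ≤ rb := by linarith
  have hra : 3 / 4 * d ≤ ra := by linarith
  have pb : d ^ 2 / 2 ≤ ip w (b - z) := by
    have h1 : ip w (b - z) = rb ^ 2 - ip (a - x) (b - x) - ip w (z - x) := by
      rw [← nl, nsq]; simp only [hw, ip, PiLp.sub_apply]; ring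
    have h2 := (abs_le.1 hrz_abs).2
    have h3 : (3 / 4 * d) ^ 2 ≤ rb ^ 2 := by gcongr
    linarith
  have pa : d ^ 2 / 2 ≤ ip w (z - a) := by
    have h1 : ip w (z - a) = ra ^ 2 - ip (a - x) (b - x) + ip w (z - x) := by
      rw [← nk, nsq]; simp only [hw, ip, PiLp.sub_apply]; ring
    have h2 := (abs_le.1 hrz_abs).1
    have h3 : (3 / 4 * d) ^ 2 ≤ ra ^ 2 := by gcongr
    linarith
  have hS := hball
  set S := cr s w (c - a) with hSd
  have pc := abs_ip_le w (c - z)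
  rw [← hL] at pc
  have pc' : L * ‖c - z‖ ≤ L := mul_le_of_le_one_right hLpos.le hcz
  have hSη : 0 < S - η := by
    have : L * (d ^ 2 * R / 8) < L * R := by
      gcongr
      have : d ^ 2 * R ≤ 1 * R := by gcongr; linarith
      linarith
    linarith
  have main : L * η < d ^ 2 / 2 * (S - η) := by
    have h1 : L * η ≤ η := mul_le_of_le_one_left hη0 hL1'
    have h2 : η * (1 + d ^ 2 / 2) ≤ η * 2 := by gcongr; linarith
    have h3 : 0 < L * R * d ^ 2 := by positivity
    have h4 : d ^ 2 / 2 * (L * R) ≤ d ^ 2 / 2 * S := by gcongr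
    linarith
  have hα : 0 < cr s (b - z) (c - z) := by
    have h := cr_expand s w (b - z) (c - z)
    have g1 : cr s w (c - z) = S - η := by
      simp only [hSd, hη, cr, PiLp.sub_apply]; ring
    have g2 : cr s w (b - z) = - η := by
      simp only [hw, hη, cr, PiLp.sub_apply]; ring
    rw [g1, g2, ← hL] at h
    have g3 : d ^ 2 / 2 * (S - η) ≤ ip w (b - z) * (S - η) := by gcongr
    have g4 : -(L * η) ≤ η * ip w (c - z) := by
      have := mul_le_mul_of_nonneg_left (abs_le.1 (pc.trans pc')).1 hη0
      linarith
    have : 0 < L ^ 2 * cr s (b - z) (c - z) := by rw [h]; linarith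
    exact pos_of_mul_pos_right this (by positivity)
  have hβ : 0 < cr s (c - z) (a - z) := by
    have h := cr_expand s w (c - z) (a - z)
    have g1 : cr s w (c - z) = S - η := by
      simp only [hSd, hη, cr, PiLp.sub_apply]; ring
    have g2 : cr s w (a - z) = - η := by
      simp only [hη, cr, PiLp.sub_apply]; ring
    have g5 : ip w (a - z) = - ip w (z - a) := by
      simp only [ip, PiLp.sub_apply]; ring
    rw [g1, g2, g5, ← hL] at h
    have g3 : d ^ 2 / 2 * (S - η) ≤ ip w (z - a) * (S - η) := by gcongr
    have g4 : η * ip w (c - z) ≤ L * η := by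
      have := mul_le_mul_of_nonneg_left (abs_le.1 (pc.trans pc')).2 hη0
      linarith
    have : 0 < L ^ 2 * cr s (c - z) (a - z) := by rw [h]; linarith
    exact pos_of_mul_pos_right this (by positivity)
  have hSpos : 0 < S := by linarith
  apply nak
  have hsumS : cr s (b - z) (c - z) + cr s (c - z) (a - z) + η = S := by
    simp only [hSd, hη, hw, cr, PiLp.sub_apply]; ring
  have e0 : S * z 0 = cr s (b - z) (c - z) * a 0 + cr s (c - z) (a - z) * b 0 + η * c 0 := by
    simp only [hSd, hη, hw, cr, PiLp.sub_apply]; ring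
  have e1 : S * z 1 = cr s (b - z) (c - z) * a 1 + cr s (c - z) (a - z) * b 1 + η * c 1 := by
    simp only [hSd, hη, hw, cr, PiLp.sub_apply]; ring
  set α := cr s (b - z) (c - z)
  set β := cr s (c - z) (a - z)
  refine ext3 (conv P) (v := z) (A := a) (B := b) (C := c) E Mk Ml Mc
          (p := α / S) (q := β / S) (r := η / S) (by positivity)
          (by positivity) (by positivity) (by rw [← add_div, ← add_div, hsumS, div_self hSpos.ne']) ?_
  ext j; fin_cases j
  · simp; field_simp; linarith
  · simp; field_simp; linarith

lemma w_sum_eq (f : Fin n → ℝ) : ∑ j, f (j - 1) = ∑ j, f j :=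
  Equiv.sum_comp (Equiv.subRight (1 : Fin n)) f

lemma w_sum_eq' (f : Fin n → ℝ) : ∑ j, f (j + 1) = ∑ j, f j :=
  Equiv.sum_comp (Equiv.addRight (1 : Fin n)) f

lemma area_sum (s : ℝ) (x : E2) :
    ∑ i, cr s (P.v i - x) (P.v (i + 1) - x) = ∑ i, cr s (P.v i) (P.v (i + 1)) := by
  have h : ∀ i, cr s (P.v i - x) (P.v (i + 1) - x) =
      cr s (P.v i) (P.v (i + 1)) + cr s x (P.v i) - cr s x (P.v (i + 1)) := by
    intro i; simp only [cr, PiLp.sub_apply]; ring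
  simp only [h, Finset.sum_sub_distrib, Finset.sum_add_distrib]
  rw [w_sum_eq' (fun i => cr s x (P.v i))]; ring

lemma w_pos {s : ℝ} (hO : Orient P s) {x : E2} (hx : x ∈ interior P.region) (i : Fin n) :
    0 < P.w i x := by
  have h1 := (edge_facts P hO hx i).1
  have h2 := (edge_facts P hO hx i).2.2.2.1
  have h3 := (edge_facts P hO hx (i - 1)).2.2.2.1
  unfold ConvexPolygon.w; positivity

lemma W_lower {s : ℝ} (hO : Orient P s) {x : E2} (hx : x ∈ interior P.region)
    (hinj : Function.Injective P.v) {d : ℝ} (hd : 0 < d)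
    (hdist : ∀ i j : Fin n, i ≠ j → d < dist (P.v i) (P.v j))
    (hr1 : ∀ m, P.r m x ≤ 1)
    {c : E2} {R : ℝ} (hR : 0 < R)
    (hb : closedBall c R ⊆ P.region) : d * R ≤ ∑ j, P.w j x := by
  have h1 : ∀ j, P.t (j - 1) x + P.t j x ≤ P.w j x := by
    intro j
    have h1 := (edge_facts P hO hx j).1
    have h2 := (edge_facts P hO hx j).2.2.2.1
    have h3 := (edge_facts P hO hx (j - 1)).2.2.2.1
    unfold ConvexPolygon.w
    rw [le_div_iff₀ h1]
    nlinarith [hr1 j]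
  have h2 : ∑ j, cr s (P.v j - x) (P.v (j + 1) - x) ≤ ∑ j, P.w j x := by
    calc _ ≤ ∑ j, 2 * P.t j x := by
          apply Finset.sum_le_sum
          intro j _
          obtain ⟨a1, a2, a3, a4, a5, a6⟩ := edge_facts P hO hx j
          rw [← a5]
          have := (abs_le.1 (abs_ip_le (P.v j - x) (P.v (j + 1) - x))).2
          rw [← r_eq, ← r_eq] at this
          have h3 : P.r j x * P.r (j + 1) x ≤ 1 * 1 := by
            gcongr
            · exact hr1 _
            · exact hr1 _
          nlinarith
      _ = ∑ j, (P.t (j - 1) x + P.t j x) := by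
          rw [Finset.sum_add_distrib, w_sum_eq (fun j => P.t j x), ← Finset.mul_sum]; ring
      _ ≤ _ := Finset.sum_le_sum (fun j _ => h1 j)
  refine le_trans ?_ h2
  rw [area_sum, ← area_sum P s c]
  have h3 : ∀ i, d * R ≤ cr s (P.v i - c) (P.v (i + 1) - c) := by
    intro i
    rw [area_eq]
    refine le_trans ?_ (ball_edge P hO hR hb i (fun h => fin_ne1 P.hn i (hinj h)))
    have := hdist _ _ (fin_ne1 P.hn i)
    gcongr
  calc d * R ≤ cr s (P.v 0 - c) (P.v (0 + 1) - c) := h3 0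
    _ ≤ _ := Finset.single_le_sum (f := fun i => cr s (P.v i - c) (P.v (i + 1) - c))
        (fun i _ => le_trans (by positivity) (h3 i)) (Finset.mem_univ 0)

lemma n_bound {d : ℝ} (hd : 0 < d) (hdist : ∀ i j : Fin n, i ≠ j → d < dist (P.v i) (P.v j))
    (hL1 : ∀ i j, dist (P.v i) (P.v j) ≤ 1) :
    (n : ℝ) ≤ ((⌊4 / d⌋₊ + 1) ^ 2 : ℕ) := by
  have hco : ∀ (a b : E2) (j : Fin 2), |a j - b j| ≤ dist a b := by
    intro a b j
    rw [dist_eq_norm]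
    have := PiLp.norm_apply_le (a - b) j
    simpa using this
  set g : Fin n → Fin 2 → ℝ := fun i j => (P.v i j - P.v 0 j + 1) * (2 / d) with hg
  have g0 : ∀ i j, 0 ≤ g i j := by
    intro i j
    have := (abs_le.1 ((hco (P.v i) (P.v 0) j).trans (hL1 _ _))).1
    have h2 : 0 ≤ P.v i j - P.v 0 j + 1 := by linarith
    simp only [hg]; positivity
  have g1 : ∀ i j, g i j ≤ 4 / d := by
    intro i j
    have := (abs_le.1 ((hco (P.v i) (P.v 0) j).trans (hL1 _ _))).2
    have h2 : P.v i j - P.v 0 j + 1 ≤ 2 := by linarith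
    calc g i j ≤ 2 * (2 / d) := by simp only [hg]; gcongr
      _ = 4 / d := by ring
  let F : Fin n → Fin (⌊4 / d⌋₊ + 1) × Fin (⌊4 / d⌋₊ + 1) := fun i =>
    (⟨⌊g i 0⌋₊, Nat.lt_succ_of_le (Nat.floor_le_floor (g1 i 0))⟩,
     ⟨⌊g i 1⌋₊, Nat.lt_succ_of_le (Nat.floor_le_floor (g1 i 1))⟩)
  have hF : Function.Injective F := by
    intro i j hij
    by_contra hne
    have h := hdist i j hne
    have e0 : ⌊g i 0⌋₊ = ⌊g j 0⌋₊ := congrArg (fun z => (z.1 : ℕ)) hij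
    have e1 : ⌊g i 1⌋₊ = ⌊g j 1⌋₊ := congrArg (fun z => (z.2 : ℕ)) hij
    have cl : ∀ l, ⌊g i l⌋₊ = ⌊g j l⌋₊ → (P.v i l - P.v j l) ^ 2 ≤ (d / 2) ^ 2 := by
      intro l hl
      have a1 := Nat.floor_le (g0 i l)
      have a2 := Nat.lt_floor_add_one (g i l)
      have a3 := Nat.floor_le (g0 j l)
      have a4 := Nat.lt_floor_add_one (g j l)
      rw [hl] at a1 a2
      have e : P.v i l - P.v j l = (g i l - g j l) * (d / 2) := by
        simp only [hg]; field_simp; ring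
      apply sq_le_sq'
      · rw [e]; nlinarith
      · rw [e]; nlinarith
    have c0 := cl 0 e0
    have c1 := cl 1 e1
    have hn := nsq (P.v i - P.v j)
    simp only [PiLp.sub_apply] at hn
    rw [dist_eq_norm] at h
    nlinarith
  have := Fintype.card_le_of_injective F hF
  simp only [Fintype.card_fin, Fintype.card_prod] at this
  rw [sq]
  exact_mod_cast this

end MV

namespace MV
open ConvexPolygon

variable {n : ℕ} [NeZero n] (P : ConvexPolygon n)

lemma bdd : Bornology.IsBounded P.region :=
  ((Set.finite_range P.v).isCompact_convexHull ℝ).isBounded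

lemma exists_ball {γ : ℝ} (hγ : 0 < γ) (hdiam : Metric.diam P.region = 1) (h1 : P.G1 γ)
    (hne : (interior P.region).Nonempty) :
    ∃ c : E2, closedBall c (1 / γ) ⊆ P.region := by
  obtain ⟨x, hx⟩ := hne
  obtain ⟨ε, hε, hball⟩ := Metric.isOpen_iff.1 isOpen_interior x hx
  have hmem : ε / 2 ∈ {r : ℝ | ∃ c : E2, Metric.closedBall c r ⊆ P.region} :=
    ⟨x, (closedBall_subset_ball (by linarith)).trans (hball.trans interior_subset)⟩
  have hbdd : BddAbove {r : ℝ | ∃ c : E2, Metric.closedBall c r ⊆ P.region} := by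
    refine ⟨1, ?_⟩
    rintro r ⟨c, hc⟩
    by_contra hr; push Not at hr
    have hc0 : c ∈ P.region := hc (mem_closedBall_self (by linarith))
    have hc1 : c + EuclideanSpace.single 0 r ∈ P.region := by
      apply hc
      rw [mem_closedBall, dist_eq_norm]
      simp [abs_of_pos (by linarith : 0 < r)]
    have := dist_le_diam_of_mem (bdd P) hc1 hc0
    rw [hdiam, dist_eq_norm] at this
    simp [abs_of_pos (by linarith : 0 < r)] at this
    linarith
  have hpos : 0 < P.inradius := lt_of_lt_of_le (by linarith) (le_csSup hbdd hmem)
  have hlt : 1 / γ < P.inradius := by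
    unfold ConvexPolygon.G1 at h1
    rw [hdiam] at h1
    rw [div_lt_iff₀ hpos] at h1
    rw [div_lt_iff₀ hγ]; linarith
  obtain ⟨r, ⟨c, hc⟩, hr⟩ := exists_lt_of_lt_csSup ⟨_, hmem⟩ hlt
  exact ⟨c, (closedBall_subset_closedBall hr.le).trans hc⟩

/-- Summary of the geometric information. -/
def Good (δ : ℝ) (x : E2) (q : Fin n) (ρ : ℝ) : Prop :=
  0 < ρ ∧ ρ ≤ 1 ∧ (∀ j, δ * ρ ≤ P.r j x) ∧ (∀ j, δ * ρ ≤ P.r j x * P.r (j + 1) x) ∧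
  (∀ j, j ≠ q → j ≠ q + 1 → δ ≤ P.r j x) ∧ (∀ j, j ≠ q → δ * P.t j x ≤ 1) ∧
  δ * (1 + P.t q x) ≤ ρ * ∑ j, P.w j x

set_option maxHeartbeats 1000000 in
lemma geometric {s : ℝ} (hO : Orient P s) {x : E2} (hx : x ∈ interior P.region)
    (hinj : Function.Injective P.v) {d : ℝ} (hd : 0 < d) (hd1 : d ≤ 1)
    (hdist : ∀ i j : Fin n, i ≠ j → d < dist (P.v i) (P.v j))
    (hr1 : ∀ m, P.r m x ≤ 1) (hL1 : ∀ i j, dist (P.v i) (P.v j) ≤ 1)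
    {c : E2} {R : ℝ} (hR : 0 < R) (hR1 : R ≤ 1)
    (hb : closedBall c R ⊆ P.region) (hcv : ∀ m, dist c (P.v m) ≤ 1) (hcx : dist c x ≤ 1) :
    ∃ q ρ, Good P (d ^ 6 * R ^ 2 / 256) x q ρ := by
  have rpos : ∀ i, 0 < P.r i x := fun i => (edge_facts P hO hx i).1
  have tpos : ∀ i, 0 < P.t i x := fun i => (edge_facts P hO hx i).2.2.2.1
  have wpos : ∀ i, 0 < P.w i x := fun i => w_pos P hO hx i
  set W := ∑ j, P.w j x with hW
  have hwW : ∀ i, P.w i x ≤ W := fun i =>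
    Finset.single_le_sum (f := fun i => P.w i x) (fun i _ => (wpos i).le) (Finset.mem_univ i)
  have hrw : ∀ i, P.t (i - 1) x + P.t i x ≤ P.r i x * W := by
    intro i
    have : P.r i x * P.w i x = P.t (i - 1) x + P.t i x := by
      unfold ConvexPolygon.w; rw [mul_div_cancel₀ _ (rpos i).ne']
    rw [← this]
    have := hwW i
    have := rpos i
    gcongr
  have hWl : d * R ≤ W := W_lower P hO hx hinj hd hdist hr1 hR hb
  obtain ⟨p, -, hp⟩ := Finset.exists_min_image Finset.univ (fun i => P.r i x)
    ⟨(0 : Fin n), Finset.mem_univ _⟩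
  obtain ⟨k, -, hk⟩ := Finset.exists_max_image Finset.univ (fun i => P.t i x)
    ⟨(0 : Fin n), Finset.mem_univ _⟩
  have hrd : ∀ m, m ≠ p → d / 2 ≤ P.r m x := by
    intro m hm
    have h1 := hdist p m hm.symm
    have h2 := dist_triangle (P.v p) x (P.v m)
    have e1 : dist (P.v p) x = P.r p x := by rw [dist_comm]; rfl
    have e2 : dist x (P.v m) = P.r m x := rfl
    have h3 := hp m (Finset.mem_univ _)
    linarith
  have htM : ∀ m, m ≠ k → P.t m x ≤ 16 / R := by
    intro m hm
    by_contra h; push Not at h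
    exact one_large P hO hx hinj hr1 hR hR1 hb hcx m k hm h.le
      (h.le.trans (hk m (Finset.mem_univ _)))
  -- numeric facts
  set δ := d ^ 6 * R ^ 2 / 256 with hδ
  have hδ0 : 0 < δ := by positivity
  have pw : ∀ a b : ℕ, a ≤ 6 → b ≤ 2 → d ^ 6 * R ^ 2 ≤ d ^ a * R ^ b := by
    intro a b ha hb
    have h1 : d ^ 6 ≤ d ^ a := pow_le_pow_of_le_one hd.le hd1 ha
    have h2 : R ^ 2 ≤ R ^ b := pow_le_pow_of_le_one hR.le hR1 hb
    gcongr
  have p00 : δ ≤ 1 / 256 := by have := pw 0 0 (by norm_num) (by norm_num); simp at this; linarith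
  have p10 : δ ≤ d / 256 := by have := pw 1 0 (by norm_num) (by norm_num); simp at this; linarith
  have p20 : δ ≤ d ^ 2 / 256 := by
    have := pw 2 0 (by norm_num) (by norm_num); simp at this; linarith
  have p21 : δ ≤ d ^ 2 * R / 256 := by
    have := pw 2 1 (by norm_num) (by norm_num); simp at this; linarith
  have p32 : δ ≤ d ^ 3 * R ^ 2 / 256 := by
    have := pw 3 2 (by norm_num) (by norm_num); linarith
  have p42 : δ ≤ d ^ 4 * R ^ 2 / 256 := by
    have := pw 4 2 (by norm_num) (by norm_num); linarith
  have pM : δ * (16 / R) ≤ 1 := by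
    rw [mul_div_assoc', div_le_one hR]
    have := pw 0 1 (by norm_num) (by norm_num); simp at this; linarith
  have hu : d ^ 3 * R ≤ 1 := by
    have : d ^ 3 * R ≤ 1 * 1 := by gcongr; exact pow_le_one₀ hd.le hd1
    linarith
  have hu0 : 0 < d ^ 3 * R := by positivity
  have pM' : δ * (32 / (d ^ 3 * R)) ≤ d ^ 3 * R / 8 := by
    rw [hδ]; field_simp; norm_num
  have hW0 : 0 < W := lt_of_lt_of_le (by positivity) hWl
  have hκ : 3 / 10 * d ^ 2 * R ≤ P.r p x * W := by
    rcases le_or_gt (P.r p x) (3 / 10 * d) with h | h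
    · have hhalf : 1 / 2 ≤ P.t (p - 1) x + P.t p x := by
        by_contra hc; push Not at hc
        have h1 := tpos p; have h2 := tpos (p - 1)
        refine near_vertex P hO hx hinj hd (p - 1) p (p + 1) (sub_add_cancel p 1) rfl
          (hrd _ ?_) (hrd _ (fin_ne1 P.hn p)) h (by linarith) (by linarith)
        intro h
        have := fin_ne1 P.hn (p - 1)
        rw [sub_add_cancel] at this
        exact this h.symm
      have : d ^ 2 * R ≤ 1 * 1 := by gcongr; exact pow_le_one₀ hd.le hd1
      linarith [hrw p]
    · have := rpos p
      have : 3 / 10 * d * (d * R) ≤ P.r p x * W := by gcongr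
      linarith
  have hd1' : δ ≤ d / 2 := by linarith
  have hadj : ∀ j, δ * P.r p x ≤ P.r j x * P.r (j + 1) x := by
    intro j
    have hpp := rpos p
    by_cases hj : j = p
    · subst hj
      have := hrd (j + 1) (fin_ne1 P.hn j)
      rw [mul_comm]
      gcongr
      linarith
    · have h1 := hrd j hj
      have h2 := hp (j + 1) (Finset.mem_univ _)
      have := rpos j
      gcongr
      linarith
  have hgoodp : ∀ q, (p = q ∨ p = q + 1) → (∀ j, j ≠ q → δ * P.t j x ≤ 1) →
      δ * (1 + P.t q x) ≤ P.r p x * W → Good P δ x q (P.r p x) := by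
    intro q hq h1 h2
    refine ⟨rpos p, hr1 p, ?_, hadj, ?_, h1, h2⟩
    · intro j
      have h3 := hp j (Finset.mem_univ _)
      have := rpos p
      nlinarith
    · intro j hj1 hj2
      refine le_trans hd1' (hrd j ?_)
      rintro rfl
      rcases hq with h | h
      · exact hj1 h
      · exact hj2 h
  by_cases hcase : p = k ∨ p = k + 1
  · refine ⟨k, P.r p x, hgoodp k hcase ?_ ?_⟩
    · intro j hj
      have := htM j hj
      calc δ * P.t j x ≤ δ * (16 / R) := by gcongr
        _ ≤ 1 := pM
    · have h1 : P.t k x ≤ P.r p x * W := by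
        have := hrw p
        rcases hcase with h | h
        · subst h; linarith [tpos (p - 1)]
        · rw [h, add_sub_cancel_right] at this
          rw [h]; linarith [tpos (k + 1)]
      have h2 : 0 < d ^ 2 * R := by positivity
      nlinarith [tpos k]
  · push Not at hcase
    rcases le_or_gt (P.t k x) (32 / (d ^ 3 * R)) with hsm | hlg
    · have hall : ∀ j, δ * P.t j x ≤ d ^ 3 * R / 8 := by
        intro j
        have h1 := hk j (Finset.mem_univ _)
        calc δ * P.t j x ≤ δ * (32 / (d ^ 3 * R)) := by gcongr; linarith
          _ ≤ _ := pM'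
      refine ⟨p, P.r p x, hgoodp p (Or.inl rfl) (fun j _ => (hall j).trans (by linarith)) ?_⟩
      have h1 := hall p
      have h2 : d ^ 3 * R ≤ d ^ 2 * R := by
        have : d ^ 3 ≤ d ^ 2 := pow_le_pow_of_le_one hd.le hd1 (by norm_num)
        gcongr
      have h3 : 0 < d ^ 2 * R := by positivity
      linarith
    · rcases le_or_gt (P.r p x) (d ^ 2 * R / 16) with hnr | hfr
      · exact (edge_vertex P hO hx hinj hd hd1 hdist hr1 hL1 hR hR1 hb hcv k (k + 1) p rfl
          hcase.1 hcase.2 hnr hlg.le).elim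
      · have hall : ∀ j, d ^ 2 * R / 16 ≤ P.r j x := by
          intro j
          have h3 := hp j (Finset.mem_univ _)
          linarith
        have h3 : 0 < d ^ 2 * R := by positivity
        have hall' : ∀ j, δ ≤ P.r j x := fun j => by linarith [hall j]
        refine ⟨k, P.r k x, rpos k, hr1 k, ?_, ?_, ?_, ?_, ?_⟩
        · intro j
          have := hall' j
          nlinarith [hr1 k, rpos k]
        · intro j
          have h4 : d ^ 2 * R / 16 * (d ^ 2 * R / 16) ≤ P.r j x * P.r (j + 1) x := by
            have := hall j
            have := hall (j + 1)
            have := rpos j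
            gcongr
          have h5 : δ * P.r k x ≤ δ * 1 := by
            have := hr1 k
            gcongr
          linarith
        · intro j _ _; exact hall' j
        · intro j hj
          have := htM j hj
          calc δ * P.t j x ≤ δ * (16 / R) := by gcongr
            _ ≤ 1 := pM
        · have h1 : P.t k x ≤ P.r k x * W := by linarith [hrw k, tpos (k - 1)]
          have h4 : d ^ 2 * R / 16 * (d * R) ≤ P.r k x * W := by
            have := hall k
            have := rpos k
            gcongr
          have h5 := tpos k
          have h6 : δ * P.t k x ≤ 1 / 256 * P.t k x := by gcongr
          linarith

end MV

namespace MV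
open ConvexPolygon

variable {n : ℕ} [NeZero n] (P : ConvexPolygon n)

lemma diff_div {f g : E2 → ℝ} {x : E2} (hf : DifferentiableAt ℝ f x)
    (hg : DifferentiableAt ℝ g x) (h : g x ≠ 0) : DifferentiableAt ℝ (f / g) x := by
  rw [div_eq_mul_inv]
  exact hf.mul (hg.inv h)

lemma r_deriv (i : Fin n) {x : E2} (h : 0 < P.r i x) :
    ∃ r' : E2 →L[ℝ] ℝ, HasFDerivAt (P.r i) r' x ∧ ‖r'‖ ≤ 1 := by
  have hd : DifferentiableAt ℝ (P.r i) x := by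
    have hne : x - P.v i ≠ 0 := by
      intro h0
      unfold ConvexPolygon.r at h
      rw [dist_eq_norm, h0, norm_zero] at h
      exact lt_irrefl _ h
    have : P.r i = fun y => ‖y - P.v i‖ := by
      funext y; unfold ConvexPolygon.r; rw [dist_eq_norm]
    rw [this]
    exact (differentiableAt_id.sub_const _).norm ℝ hne
  refine ⟨fderiv ℝ (P.r i) x, hd.hasFDerivAt, ?_⟩
  have := norm_fderiv_le_of_lipschitz ℝ (f := P.r i) (x₀ := x) (C := 1)
    (LipschitzWith.dist_left (P.v i))
  simpa using this

lemma A_deriv {s : ℝ} (hs : s ^ 2 = 1) (i : Fin n) (x : E2)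
    (hL : dist (P.v (i + 1)) (P.v i) ≤ 1) :
    ∃ A' : E2 →L[ℝ] ℝ, HasFDerivAt (fun y => cr s (P.v i - y) (P.v (i + 1) - y)) A' x ∧ ‖A'‖ ≤ 1 := by
  have hd : DifferentiableAt ℝ (fun y => cr s (P.v i - y) (P.v (i + 1) - y)) x := by
    simp only [cr, PiLp.sub_apply]
    fun_prop
  refine ⟨_, hd.hasFDerivAt, ?_⟩
  have hl : LipschitzWith 1 (fun y => cr s (P.v i - y) (P.v (i + 1) - y)) := by
    apply LipschitzWith.of_dist_le_mul
    intro y z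
    rw [Real.dist_eq]
    have : cr s (P.v i - y) (P.v (i + 1) - y) - cr s (P.v i - z) (P.v (i + 1) - z)
        = cr s (P.v (i + 1) - P.v i) (y - z) := by
      simp only [cr, PiLp.sub_apply]; ring
    rw [this]
    refine (abs_cr_le hs _ _).trans ?_
    rw [← dist_eq_norm, ← dist_eq_norm]
    simp only [NNReal.coe_one]
    gcongr
  simpa using norm_fderiv_le_of_lipschitz ℝ hl (x₀ := x)

set_option maxHeartbeats 1000000 in
lemma t_deriv {s : ℝ} (hO : Orient P s) (i : Fin n) {x : E2} (hx : x ∈ interior P.region)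
    (hL : dist (P.v (i + 1)) (P.v i) ≤ 1) (hr1 : ∀ m, P.r m x ≤ 1) :
    ∃ t' : E2 →L[ℝ] ℝ, HasFDerivAt (P.t i) t' x ∧
      P.r i x * P.r (i + 1) x * ‖t'‖ ≤ 3 * (1 + P.t i x ^ 2) := by
  obtain ⟨a1, a2, a3, a4, a5, a6⟩ := edge_facts P hO hx i
  obtain ⟨r1, hr, hrn⟩ := r_deriv P i a1
  obtain ⟨r2, hr', hrn'⟩ := r_deriv P (i + 1) a2
  obtain ⟨A', hA, hAn⟩ := A_deriv P hO.1 i x hL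
  set D : E2 → ℝ := fun y => ip (P.v i - y) (P.v (i + 1) - y) with hDd
  have hDeq : D = fun y => (1 / 2 : ℝ) * (P.r i y * P.r i y + P.r (i + 1) y * P.r (i + 1) y
      - ‖P.v i - P.v (i + 1)‖ ^ 2) := by
    funext y
    simp only [hDd, r_eq]
    have h := nsq_sub (P.v i - y) (P.v (i + 1) - y)
    rw [sub_sub_sub_cancel_right] at h
    rw [h]; ring
  have hD : HasFDerivAt D ((1 / 2 : ℝ) • (P.r i x • r1 + P.r i x • r1 +
      (P.r (i + 1) x • r2 + P.r (i + 1) x • r2))) x := by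
    rw [hDeq]
    exact (((hr.mul hr).add (hr'.mul hr')).sub_const _).const_mul _
  set D' := ((1 / 2 : ℝ) • (P.r i x • r1 + P.r i x • r1 +
      (P.r (i + 1) x • r2 + P.r (i + 1) x • r2))) with hD'
  have hM := hr.mul hr'
  set M' := P.r i x • r2 + P.r (i + 1) x • r1 with hM'
  have hQ := hM.add hD
  have hN := hM.sub hD
  set A : E2 → ℝ := fun y => cr s (P.v i - y) (P.v (i + 1) - y) with hAd
  have hev : ∀ᶠ y in nhds x, y ∈ interior P.region := isOpen_interior.mem_nhds hx
  have ht : DifferentiableAt ℝ (P.t i) x := by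
    have hne : ((P.r i * P.r (i + 1)) + D) x ≠ 0 := a3.ne'
    have h1 : DifferentiableAt ℝ (A / (P.r i * P.r (i + 1) + D)) x :=
      diff_div hA.differentiableAt hQ.differentiableAt hne
    refine h1.congr_of_eventuallyEq ?_
    filter_upwards [hev] with y hy
    obtain ⟨b1, b2, b3, b4, b5, b6⟩ := edge_facts P hO hy i
    simp only [Pi.div_apply, Pi.add_apply, Pi.mul_apply, hAd, hDd]
    rw [eq_div_iff b3.ne', b5]
  have htd := ht.hasFDerivAt
  set t' := fderiv ℝ (P.t i) x with ht'
  refine ⟨t', htd, ?_⟩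
  set Q := P.r i x * P.r (i + 1) x + D x with hQd
  have hE1 : P.t i x • (M' + D') + Q • t' = A' := by
    have h1 := htd.mul hQ
    have h2 : HasFDerivAt A (P.t i x • (M' + D') + (((P.r i * P.r (i + 1)) + D) x) • t') x := by
      refine h1.congr_of_eventuallyEq ?_
      filter_upwards [hev] with y hy
      obtain ⟨b1, b2, b3, b4, b5, b6⟩ := edge_facts P hO hy i
      simp only [Pi.add_apply, Pi.mul_apply, hAd, hDd]
      rw [b5]
    exact h2.unique hA
  have hE2 : P.t i x • A' + A x • t' = M' - D' := by
    have h1 := htd.mul hA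
    have h2 : HasFDerivAt (P.r i * P.r (i + 1) - D) (P.t i x • A' + A x • t') x := by
      refine h1.congr_of_eventuallyEq ?_
      filter_upwards [hev] with y hy
      obtain ⟨b1, b2, b3, b4, b5, b6⟩ := edge_facts P hO hy i
      simp only [Pi.sub_apply, Pi.mul_apply, hAd, hDd]
      rw [b6]
    exact h2.unique hN
  have hAx : A x = P.t i x * Q := a5.symm
  have hNx : P.t i x * A x = P.r i x * P.r (i + 1) x - D x := a6
  have hq1 := hr1 i
  have hq2 := hr1 (i + 1)
  have hQpos : 0 < Q := a3
  clear_value Q t' D' M' A D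
  generalize P.t i x = t at *
  generalize P.r i x = ra at *
  generalize P.r (i + 1) x = rb at *
  have e1 : M' + D' = (ra + rb) • (r1 + r2) := by
    rw [hM', hD']; ext h; simp; ring
  have e2 : M' - D' = (rb - ra) • (r1 - r2) := by
    rw [hM', hD']; ext h; simp; ring
  have n1 : ‖M' + D'‖ ≤ 4 := by
    rw [e1, norm_smul, Real.norm_eq_abs, abs_of_pos (by linarith)]
    have := norm_add_le r1 r2
    nlinarith [norm_nonneg (r1 + r2)]
  have n2 : ‖M' - D'‖ ≤ 2 := by
    rw [e2, norm_smul, Real.norm_eq_abs]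
    have := norm_sub_le r1 r2
    have h3 : |rb - ra| ≤ 1 := by rw [abs_le]; constructor <;> linarith
    nlinarith [norm_nonneg (r1 - r2)]
  have key : ((1 + t) * Q) • t' = (M' - D') + (1 - t) • A' - t • (M' + D') := by
    have f1 : Q • t' = A' - t • (M' + D') := by rw [← hE1]; abel
    have f2 : (t * Q) • t' = (M' - D') - t • A' := by rw [← hE2, hAx]; abel
    rw [add_mul, add_smul, one_mul, f1, f2]; module
  have hn : (1 + t) * Q * ‖t'‖ ≤ 6 * (1 + t) := by
    have h1 : (1 + t) * Q * ‖t'‖ = ‖((1 + t) * Q) • t'‖ := by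
      rw [norm_smul, Real.norm_eq_abs, abs_of_pos (by positivity)]
    rw [h1, key]
    have h2 := norm_sub_le ((M' - D') + (1 - t) • A') (t • (M' + D'))
    have h3 := norm_add_le (M' - D') ((1 - t) • A')
    rw [norm_smul t, Real.norm_eq_abs, abs_of_pos a4] at h2
    rw [norm_smul (1 - t), Real.norm_eq_abs] at h3
    have h4 : |1 - t| ≤ 1 + t := by rw [abs_le]; constructor <;> linarith
    have h5 : |1 - t| * ‖A'‖ ≤ (1 + t) * 1 := by gcongr
    have h6 : t * ‖M' + D'‖ ≤ t * 4 := by gcongr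
    linarith
  have hn' : Q * ‖t'‖ ≤ 6 := by
    have : (1 + t) * (Q * ‖t'‖) ≤ (1 + t) * 6 := by linarith
    exact le_of_mul_le_mul_left this (by linarith)
  have h2r : 2 * (ra * rb) = Q * (1 + t ^ 2) := by
    rw [hAx] at hNx
    rw [hQd] at hNx ⊢; linear_combination -hNx
  have : 2 * (ra * rb * ‖t'‖) ≤ 6 * (1 + t ^ 2) := by
    calc 2 * (ra * rb * ‖t'‖) = (2 * (ra * rb)) * ‖t'‖ := by ring
      _ = (Q * ‖t'‖) * (1 + t ^ 2) := by rw [h2r]; ring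
      _ ≤ 6 * (1 + t ^ 2) := by gcongr
  linarith

end MV

namespace MV
open ConvexPolygon

/-- Derivative bound for a single weight. -/
lemma w_bound {V : Type*} [SeminormedAddCommGroup V] [NormedSpace ℝ V] {r w a b ι α β : ℝ}
    {ta tb r' w' : V} (hr : 0 < r) (hι : 1 ≤ ι * r) (ha : 0 ≤ a)
    (hb : 0 ≤ b) (haα : a ≤ α) (hbα : b ≤ α) (hta : ‖ta‖ ≤ β) (htb : ‖tb‖ ≤ β) (hr' : ‖r'‖ ≤ 1)
    (hw : r * w = a + b) (hw' : r • w' = ta + tb - w • r') :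
    0 ≤ w ∧ w ≤ 2 * α * ι ∧ ‖w'‖ ≤ ι * (2 * β + 2 * α * ι) := by
  have hι0 : 0 < ι := by
    by_contra h
    push Not at h
    nlinarith
  have hw0 : 0 ≤ w := by
    by_contra h
    push Not at h
    nlinarith
  have h1 : w ≤ 2 * α * ι := by
    have : w * 1 ≤ w * (ι * r) := by gcongr
    have h2 : w * (ι * r) = ι * (a + b) := by rw [← hw]; ring
    have h3 : ι * (a + b) ≤ ι * (α + α) := by gcongr
    linarith
  refine ⟨hw0, h1, ?_⟩
  have h2 : r * ‖w'‖ ≤ 2 * β + 2 * α * ι := by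
    have : r * ‖w'‖ = ‖r • w'‖ := by rw [norm_smul, Real.norm_eq_abs, abs_of_pos hr]
    rw [this, hw']
    have h3 := norm_sub_le (ta + tb) (w • r')
    have h4 := norm_add_le ta tb
    rw [norm_smul, Real.norm_eq_abs, abs_of_nonneg hw0] at h3
    have h5 : w * ‖r'‖ ≤ w * 1 := by gcongr
    linarith
  have h3 : ‖w'‖ * 1 ≤ ‖w'‖ * (ι * r) := by gcongr
  have h4 : ι * (r * ‖w'‖) ≤ ι * (2 * β + 2 * α * ι) := by gcongr
  linarith

lemma pair_bound {V : Type*} [SeminormedAddCommGroup V] [NormedSpace ℝ V] {w₁ w₂ a₁ a₂ b₁ b₂ : ℝ}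
    {w₁' w₂' : V} (h1 : 0 ≤ w₁) (h2 : 0 ≤ w₂) (h3 : w₁ ≤ a₁) (h4 : w₂ ≤ a₂)
    (h5 : ‖w₁'‖ ≤ b₁) (h6 : ‖w₂'‖ ≤ b₂) :
    ‖w₁ • w₂' - w₂ • w₁'‖ ≤ a₁ * b₂ + a₂ * b₁ := by
  have := norm_sub_le (w₁ • w₂') (w₂ • w₁')
  rw [norm_smul, norm_smul, Real.norm_eq_abs, Real.norm_eq_abs, abs_of_nonneg h1,
    abs_of_nonneg h2] at this
  have e1 : w₁ * ‖w₂'‖ ≤ a₁ * b₂ := by gcongr; linarith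
  have e2 : w₂ * ‖w₁'‖ ≤ a₂ * b₁ := by gcongr; linarith
  linarith

/-- The delicate pair: the two endpoints of the nearest edge. -/
lemma special_pair {V : Type*} [SeminormedAddCommGroup V] [NormedSpace ℝ V]
    {K Y τ b c rp rq wp wq : ℝ} {τ' b' c' rp' rq' wp' wq' : V}
    (hK : 1 ≤ K) (hY : 1 ≤ Y) (hτ : 0 ≤ τ) (hb : 0 ≤ b) (hc : 0 ≤ c) (hbK : b ≤ K) (hcK : c ≤ K)
    (hrp : 0 < rp) (hrq : 0 < rq) (hrr : 1 ≤ K * Y * (rp * rq))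
    (hτ' : ‖τ'‖ ≤ 6 * K ^ 3 * (1 + τ) ^ 2 * Y) (hb' : ‖b'‖ ≤ 6 * K ^ 3 * Y)
    (hc' : ‖c'‖ ≤ 6 * K ^ 3 * Y) (hrp' : ‖rp'‖ ≤ 1) (hrq' : ‖rq'‖ ≤ 1)
    (hwp0 : 0 ≤ wp) (hwq0 : 0 ≤ wq)
    (hwpb : wp ≤ 2 * K ^ 2 * ((1 + τ) * Y)) (hwqb : wq ≤ 2 * K ^ 2 * ((1 + τ) * Y))
    (hwp : rp * wp = b + τ) (hwq : rq * wq = τ + c)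
    (hwp' : rp • wp' = b' + τ' - wp • rp') (hwq' : rq • wq' = τ' + c' - wq • rq') :
    ‖wp • wq' - wq • wp'‖ ≤ 56 * K ^ 6 * ((1 + τ) * Y) ^ 2 := by
  have key : (rp * rq) • (wp • wq' - wq • wp') = (b - c) • τ' + (τ + b) • c' - (τ + c) • b'
      - ((τ + b) * wq) • rq' + ((τ + c) * wp) • rp' := by
    have : (rp * rq) • (wp • wq' - wq • wp') = (rp * wp) • (rq • wq') - (rq * wq) • (rp • wp') := by
      module
    rw [this, hwp, hwq, hwp', hwq']
    module
  set T := 1 + τ with hT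
  have hT1 : 1 ≤ T := by linarith
  have hK0 : 0 < K := by linarith
  have hY0 : 0 < Y := by linarith
  have hτb : τ + b ≤ K * T := by nlinarith
  have hτc : τ + c ≤ K * T := by nlinarith
  have hTT : T ≤ T ^ 2 := by nlinarith
  have hK34 : K ^ 3 ≤ K ^ 4 := pow_le_pow_right₀ hK (by norm_num)
  have n1 : ‖(b - c) • τ'‖ ≤ 6 * (K ^ 4 * T ^ 2 * Y) := by
    rw [norm_smul, Real.norm_eq_abs]
    have : |b - c| ≤ K := by rw [abs_le]; constructor <;> linarith
    calc |b - c| * ‖τ'‖ ≤ K * (6 * K ^ 3 * T ^ 2 * Y) := by gcongr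
      _ = _ := by ring
  have aux : K * T * (6 * K ^ 3 * Y) ≤ 6 * (K ^ 4 * T ^ 2 * Y) := by
    calc K * T * (6 * K ^ 3 * Y) = 6 * (K ^ 4 * T * Y) := by ring
      _ ≤ _ := by gcongr
  have n2 : ‖(τ + b) • c'‖ ≤ 6 * (K ^ 4 * T ^ 2 * Y) := by
    rw [norm_smul, Real.norm_eq_abs, abs_of_nonneg (by linarith)]
    exact le_trans (by gcongr) aux
  have n3 : ‖(τ + c) • b'‖ ≤ 6 * (K ^ 4 * T ^ 2 * Y) := by
    rw [norm_smul, Real.norm_eq_abs, abs_of_nonneg (by linarith)]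
    exact le_trans (by gcongr) aux
  have aux2 : K * T * (2 * K ^ 2 * (T * Y)) * 1 ≤ 2 * (K ^ 4 * T ^ 2 * Y) := by
    calc K * T * (2 * K ^ 2 * (T * Y)) * 1 = 2 * (K ^ 3 * T ^ 2 * Y) := by ring
      _ ≤ _ := by gcongr
  have n4 : ‖((τ + b) * wq) • rq'‖ ≤ 2 * (K ^ 4 * T ^ 2 * Y) := by
    rw [norm_smul, Real.norm_eq_abs, abs_of_nonneg (by positivity)]
    exact le_trans (by gcongr) aux2
  have n5 : ‖((τ + c) * wp) • rp'‖ ≤ 2 * (K ^ 4 * T ^ 2 * Y) := by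
    rw [norm_smul, Real.norm_eq_abs, abs_of_nonneg (by positivity)]
    exact le_trans (by gcongr) aux2
  have hn : rp * rq * ‖wp • wq' - wq • wp'‖ ≤ 22 * (K ^ 4 * T ^ 2 * Y) := by
    have : rp * rq * ‖wp • wq' - wq • wp'‖ = ‖(rp * rq) • (wp • wq' - wq • wp')‖ := by
      rw [norm_smul, Real.norm_eq_abs, abs_of_pos (by positivity)]
    rw [this, key]
    have m1 := norm_add_le ((b - c) • τ' + (τ + b) • c' - (τ + c) • b'
      - ((τ + b) * wq) • rq') (((τ + c) * wp) • rp')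
    have m2 := norm_sub_le ((b - c) • τ' + (τ + b) • c' - (τ + c) • b') (((τ + b) * wq) • rq')
    have m3 := norm_sub_le ((b - c) • τ' + (τ + b) • c') ((τ + c) • b')
    have m4 := norm_add_le ((b - c) • τ') ((τ + b) • c')
    linarith
  set Z := ‖wp • wq' - wq • wp'‖
  have hZ : 0 ≤ Z := norm_nonneg _
  calc Z = 1 * Z := by ring
    _ ≤ K * Y * (rp * rq) * Z := by gcongr
    _ = K * Y * (rp * rq * Z) := by ring
    _ ≤ K * Y * (22 * (K ^ 4 * T ^ 2 * Y)) := by gcongr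
    _ = 22 * K ^ 5 * (T * Y) ^ 2 := by ring
    _ ≤ 56 * K ^ 6 * (T * Y) ^ 2 := by
      have : K ^ 5 ≤ K ^ 6 := pow_le_pow_right₀ hK (by norm_num)
      have h0 : 0 ≤ K ^ 5 := by positivity
      gcongr
      norm_num

lemma final_bound {V : Type*} [SeminormedAddCommGroup V] [NormedSpace ℝ V] {n : ℕ}
    {W K X : ℝ} {l : V} {f : Fin n → V} (hW : 0 < W) (hK : 0 < K) (hX : 0 ≤ X) (hXW : X ≤ K * W)
    (hfin : W ^ 2 • l = ∑ j, f j) (hf : ∀ j, ‖f j‖ ≤ 56 * K ^ 6 * X ^ 2) :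
    ‖l‖ ≤ n * (56 * K ^ 8) := by
  have hW2 : 0 < W ^ 2 := by positivity
  have hnorm : W ^ 2 * ‖l‖ ≤ n * (56 * K ^ 6 * X ^ 2) := by
    have : W ^ 2 * ‖l‖ = ‖W ^ 2 • l‖ := by
      rw [norm_smul, Real.norm_eq_abs, abs_of_pos hW2]
    rw [this, hfin]
    refine (norm_sum_le _ _).trans ?_
    refine (Finset.sum_le_sum fun j _ => hf j).trans ?_
    simp
  have hlast : W ^ 2 * ‖l‖ ≤ W ^ 2 * (n * (56 * K ^ 8)) := by
    refine hnorm.trans ?_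
    calc (n : ℝ) * (56 * K ^ 6 * X ^ 2) ≤ n * (56 * K ^ 6 * (K * W) ^ 2) := by gcongr
      _ = _ := by ring
  exact le_of_mul_le_mul_left hlast hW2

variable {n : ℕ} [NeZero n] (P : ConvexPolygon n)

set_option maxHeartbeats 1000000 in
lemma lambda_bound {s : ℝ} (hO : Orient P s) {x : E2} (hx : x ∈ interior P.region)
    (hr1 : ∀ m, P.r m x ≤ 1) (hL1 : ∀ i j, dist (P.v i) (P.v j) ≤ 1)
    {K ρ : ℝ} {q : Fin n} (hK : 1 ≤ K) (hG : Good P (1 / K) x q ρ) (i : Fin n) :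
    ∃ l' : E2 →L[ℝ] ℝ, HasFDerivAt (P.lambda i) l' x ∧ ‖l'‖ ≤ n * (56 * K ^ 8) := by
  obtain ⟨g1, g2, g3, g4, g5, g6, g7⟩ := hG
  have hK0 : 0 < K := by linarith
  have hn := P.hn
  have hne1 : ∀ j : Fin n, j - 1 ≠ j := fun j h => by
    have := fin_ne1 hn (j - 1)
    rw [sub_add_cancel] at this
    exact this h.symm
  have mulK : ∀ {a b : ℝ}, 1 / K * a ≤ b → a ≤ K * b := by
    intro a b h
    rw [one_div, inv_mul_le_iff₀ hK0] at h
    exact h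
  have hpos : ∀ j, 0 < P.r j x := fun j => (edge_facts P hO hx j).1
  have htpos : ∀ j, 0 < P.t j x := fun j => (edge_facts P hO hx j).2.2.2.1
  choose r' hr' hrn using fun j => r_deriv P j (hpos j)
  choose t' ht' htn using fun j => t_deriv P hO j hx (hL1 (j + 1) j) hr1
  have hwd : ∀ j, DifferentiableAt ℝ (P.w j) x := fun j =>
    (diff_div ((ht' (j - 1)).add (ht' j)).differentiableAt (hr' j).differentiableAt (hpos j).ne' :
      DifferentiableAt ℝ ((P.t (j - 1) + P.t j) / P.r j) x)
  set w' := fun j => fderiv ℝ (P.w j) x with hw'd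
  have hw' : ∀ j, HasFDerivAt (P.w j) (w' j) x := fun j => (hwd j).hasFDerivAt
  have hev : ∀ᶠ y in nhds x, y ∈ interior P.region := isOpen_interior.mem_nhds hx
  have hweq : ∀ y ∈ interior P.region, ∀ j, P.r j y * P.w j y = P.t (j - 1) y + P.t j y := by
    intro y hy j
    have := (edge_facts P hO hy j).1
    unfold ConvexPolygon.w
    field_simp
  have hwdeq : ∀ j, P.r j x • w' j = t' (j - 1) + t' j - P.w j x • r' j := by
    intro j
    have h1 := (hr' j).mul (hw' j)
    have h2 : HasFDerivAt (P.r j * P.w j) (t' (j - 1) + t' j) x := by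
      refine ((ht' (j - 1)).add (ht' j)).congr_of_eventuallyEq ?_
      filter_upwards [hev] with y hy
      simpa using hweq y hy j
    rw [← h1.unique h2]; abel
  set Y := 1 / ρ with hY
  have hY1 : 1 ≤ Y := by rw [hY, le_div_iff₀ g1]; linarith
  have hρY : ρ * Y = 1 := by rw [hY]; field_simp
  set τ := P.t q x with hτd
  have hτ : 0 < τ := htpos q
  have htK : ∀ j, j ≠ q → P.t j x ≤ K := fun j hj => by
    have := mulK (g6 j hj); linarith
  have htKT : ∀ j, P.t j x ≤ K * (1 + τ) := fun j => by
    by_cases hj : j = q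
    · rw [hj]; nlinarith
    · have := htK j hj; nlinarith
  have hrr : ∀ j, 1 ≤ K * Y * (P.r j x * P.r (j + 1) x) := fun j => by
    have h := mulK (g4 j)
    calc (1 : ℝ) = ρ * Y := hρY.symm
      _ ≤ (K * (P.r j x * P.r (j + 1) x)) * Y := by gcongr
      _ = _ := by ring
  have hrY : ∀ j, 1 ≤ K * Y * P.r j x := fun j => by
    have h := mulK (g3 j)
    calc (1 : ℝ) = ρ * Y := hρY.symm
      _ ≤ (K * P.r j x) * Y := by gcongr
      _ = _ := by ring
  have htn2 : ∀ j, ‖t' j‖ ≤ K * Y * (3 * (1 + P.t j x ^ 2)) := fun j => by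
    calc ‖t' j‖ = 1 * ‖t' j‖ := by ring
      _ ≤ K * Y * (P.r j x * P.r (j + 1) x) * ‖t' j‖ := by
        gcongr; exact hrr j
      _ = K * Y * (P.r j x * P.r (j + 1) x * ‖t' j‖) := by ring
      _ ≤ _ := mul_le_mul_of_nonneg_left (htn j) (by positivity)
  have ht1 : ∀ j, j ≠ q → ‖t' j‖ ≤ 6 * K ^ 3 * Y := fun j hj => by
    refine (htn2 j).trans ?_
    have h1 : P.t j x ^ 2 ≤ K ^ 2 := by
      have := htpos j; have := htK j hj; gcongr
    have h2 : 1 ≤ K ^ 2 := one_le_pow₀ hK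
    calc K * Y * (3 * (1 + P.t j x ^ 2)) ≤ K * Y * (3 * (K ^ 2 + K ^ 2)) := by gcongr
      _ = _ := by ring
  have ht2 : ∀ j, ‖t' j‖ ≤ 6 * K ^ 3 * (1 + τ) ^ 2 * Y := fun j => by
    refine (htn2 j).trans ?_
    have h1 : P.t j x ^ 2 ≤ (K * (1 + τ)) ^ 2 := by
      have := htpos j; have := htKT j; gcongr
    have h2 : 1 ≤ (K * (1 + τ)) ^ 2 := one_le_pow₀ (by nlinarith)
    calc K * Y * (3 * (1 + P.t j x ^ 2)) ≤ K * Y * (3 * ((K * (1 + τ)) ^ 2 + (K * (1 + τ)) ^ 2)) := by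
          gcongr
      _ = _ := by ring
  set X := (1 + τ) * Y with hX
  have hX1 : 1 ≤ X := by rw [hX]; nlinarith
  have hYX : Y ≤ X := by rw [hX]; nlinarith
  -- all weights
  have hall : ∀ j, 0 ≤ P.w j x ∧ P.w j x ≤ 2 * K ^ 2 * X ∧ ‖w' j‖ ≤ 14 * K ^ 4 * X ^ 2 := by
    intro j
    obtain ⟨h0, h1, h2⟩ := w_bound (hpos j) (hrY j) (htpos (j - 1)).le (htpos j).le (htKT _)
      (htKT _) (ht2 _) (ht2 _) (hrn j) (hweq x hx j) (hwdeq j)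
    refine ⟨h0, h1.trans (le_of_eq (by rw [hX]; ring)), h2.trans ?_⟩
    have h34 : K ^ 3 ≤ K ^ 4 := pow_le_pow_right₀ hK (by norm_num)
    calc K * Y * (2 * (6 * K ^ 3 * (1 + τ) ^ 2 * Y) + 2 * (K * (1 + τ)) * (K * Y))
        = 12 * K ^ 4 * X ^ 2 + 2 * K ^ 3 * (X * Y) := by rw [hX]; ring
      _ ≤ 12 * K ^ 4 * X ^ 2 + 2 * K ^ 4 * (X * X) := by gcongr
      _ = _ := by ring
  have hoth : ∀ j, j ≠ q → j ≠ q + 1 → P.w j x ≤ 2 * K ^ 2 ∧ ‖w' j‖ ≤ 14 * K ^ 4 * X := by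
    intro j hj hj1
    have hj2 : j - 1 ≠ q := fun h => hj1 (by rw [← h, sub_add_cancel])
    have hr := mulK (a := 1) (by simpa using g5 j hj hj1)
    obtain ⟨h0, h1, h2⟩ := w_bound (hpos j) hr (htpos (j - 1)).le (htpos j).le (htK _ hj2)
      (htK _ hj) (ht1 _ hj2) (ht1 _ hj) (hrn j) (hweq x hx j) (hwdeq j)
    refine ⟨h1.trans (le_of_eq (by ring)), h2.trans ?_⟩
    have h34 : K ^ 3 ≤ K ^ 4 := pow_le_pow_right₀ hK (by norm_num)
    calc K * (2 * (6 * K ^ 3 * Y) + 2 * K * K)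
        = 12 * K ^ 4 * Y + 2 * K ^ 3 * 1 := by ring
      _ ≤ 12 * K ^ 4 * X + 2 * K ^ 4 * X := by gcongr
      _ = _ := by ring
  have hXX : X ≤ X ^ 2 := by nlinarith
  -- a pair with a non-special first member
  have hpo : ∀ j k, j ≠ q → j ≠ q + 1 →
      ‖P.w j x • w' k - P.w k x • w' j‖ ≤ 56 * K ^ 6 * X ^ 2 := by
    intro j k hj hj1
    obtain ⟨h1, h2⟩ := hoth j hj hj1
    obtain ⟨h3, h4, h5⟩ := hall k
    refine (pair_bound (hall j).1 h3 h1 h4 h2 h5).trans (le_of_eq (by ring))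
  have hsp : ‖P.w q x • w' (q + 1) - P.w (q + 1) x • w' q‖ ≤ 56 * K ^ 6 * X ^ 2 := by
    have e1 := hweq x hx (q + 1)
    have e2 := hwdeq (q + 1)
    rw [add_sub_cancel_right] at e1 e2
    exact special_pair hK hY1 hτ.le (htpos (q - 1)).le (htpos (q + 1)).le (htK _ (hne1 q))
      (htK _ (fin_ne1 hn q)) (hpos q) (hpos (q + 1)) (hrr q) (ht2 q) (ht1 _ (hne1 q))
      (ht1 _ (fin_ne1 hn q)) (hrn q) (hrn (q + 1)) (hall q).1 (hall (q + 1)).1 (hall q).2.1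
      (hall (q + 1)).2.1 (hweq x hx q) e1 (hwdeq q) e2
  have hsymm : ∀ j k, ‖P.w j x • w' k - P.w k x • w' j‖ = ‖P.w k x • w' j - P.w j x • w' k‖ :=
    fun j k => norm_sub_rev _ _
  have hpair : ∀ j k, ‖P.w j x • w' k - P.w k x • w' j‖ ≤ 56 * K ^ 6 * X ^ 2 := by
    intro j k
    by_cases hjk : j = k
    · rw [hjk, sub_self, norm_zero]; positivity
    by_cases hj : j ≠ q ∧ j ≠ q + 1
    · exact hpo j k hj.1 hj.2
    by_cases hk : k ≠ q ∧ k ≠ q + 1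
    · rw [hsymm]; exact hpo k j hk.1 hk.2
    have hj' : j = q ∨ j = q + 1 := by tauto
    have hk' : k = q ∨ k = q + 1 := by tauto
    rcases hj' with rfl | rfl <;> rcases hk' with rfl | rfl
    · exact absurd rfl hjk
    · exact hsp
    · rw [hsymm]; exact hsp
    · exact absurd rfl hjk
  set W := ∑ j, P.w j x with hW
  have hXW : X ≤ K * W := by
    have h := mulK g7
    calc X = (1 + τ) * Y := hX
      _ ≤ K * (ρ * W) * Y := by gcongr
      _ = K * W * (ρ * Y) := by ring
      _ = K * W := by rw [hρY, mul_one]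
  have hWpos : 0 < W := by
    by_contra h
    push Not at h
    nlinarith
  have hWd : HasFDerivAt (fun y => ∑ j, P.w j y) (∑ j, w' j) x :=
    HasFDerivAt.fun_sum fun j _ => hw' j
  have hld : DifferentiableAt ℝ (P.lambda i) x :=
    (diff_div (hwd i) hWd.differentiableAt hWpos.ne' :
      DifferentiableAt ℝ (P.w i / (fun y => ∑ j, P.w j y)) x)
  refine ⟨fderiv ℝ (P.lambda i) x, hld.hasFDerivAt, ?_⟩
  set l' := fderiv ℝ (P.lambda i) x with hl'
  have hlW : P.lambda i x * W = P.w i x := by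
    unfold ConvexPolygon.lambda
    exact div_mul_cancel₀ _ hWpos.ne'
  have hle : P.lambda i x • (∑ j, w' j) + W • l' = w' i := by
    have h1 := hld.hasFDerivAt.mul hWd
    refine HasFDerivAt.unique ?_ (hw' i)
    refine h1.congr_of_eventuallyEq ?_
    filter_upwards [hev] with y hy
    have : 0 < ∑ j, P.w j y :=
      Finset.sum_pos (fun j _ => w_pos P hO hy j) ⟨q, Finset.mem_univ q⟩
    simp only [Pi.mul_apply]
    unfold ConvexPolygon.lambda
    exact (div_mul_cancel₀ _ this.ne').symm
  have hfin : W ^ 2 • l' = ∑ j, (P.w j x • w' i - P.w i x • w' j) := by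
    rw [Finset.sum_sub_distrib, ← Finset.sum_smul, ← Finset.smul_sum, ← hW]
    have h1 : W • l' = w' i - P.lambda i x • (∑ j, w' j) := by rw [← hle]; abel
    rw [pow_two, mul_smul, h1, smul_sub, smul_smul, mul_comm W, hlW]
  exact final_bound hWpos hK0 (by linarith) hXW hfin fun j => hpair j i

end MV

open ConvexPolygon in
/-- Main Theorem: under G1 and G2 there is a uniform constant `C` such
that each mean value coordinate `λ_i` is differentiable on the interior of the polygon
with `‖∇λ_i(x)‖ ≤ C`. -/
theorem mean_value_gradient_bound (γstar dstar : ℝ) (hγ : 0 < γstar) (hd : 0 < dstar) :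
    ∃ C : ℝ, 0 < C ∧
      ∀ (n : ℕ) [NeZero n] (P : ConvexPolygon n),
        Metric.diam P.region = 1 → P.G1 γstar → P.G2 dstar →
        ∀ (i : Fin n), ∀ x ∈ interior P.region,
          DifferentiableAt ℝ (P.lambda i) x ∧ ‖gradient (P.lambda i) x‖ ≤ C := by
  set R := min 1 (1 / γstar) with hR
  have hR0 : 0 < R := lt_min one_pos (by positivity)
  have hR1 : R ≤ 1 := min_le_left _ _
  set K := 256 / (dstar ^ 6 * R ^ 2) with hK
  have hK0 : 0 < K := by positivity
  refine ⟨(((⌊4 / dstar⌋₊ + 1) ^ 2 : ℕ) : ℝ) * (56 * K ^ 8), by positivity, ?_⟩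
  intro n _ P hdiam h1 h2 i x hx
  have hx' : x ∈ P.region := interior_subset hx
  have hne : (interior P.region).Nonempty := ⟨x, hx⟩
  have hle : ∀ {a b : E2}, a ∈ P.region → b ∈ P.region → dist a b ≤ 1 := fun ha hb =>
    hdiam ▸ Metric.dist_le_diam_of_mem (MV.bdd P) ha hb
  have hinj : Function.Injective P.v := by
    intro a b hab
    by_contra h
    have := h2 a b h
    rw [hab, dist_self] at this
    linarith
  have hd1 : dstar ≤ 1 := by
    have := h2 (0 + 1) 0 (MV.fin_ne1 P.hn 0)
    exact this.le.trans (hle (MV.v_mem P _) (MV.v_mem P _))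
  obtain ⟨s, hO⟩ := MV.exists_orient P hne hinj
  obtain ⟨c, hc⟩ := MV.exists_ball P hγ hdiam h1 hne
  have hcm : c ∈ P.region := hc (Metric.mem_closedBall_self (by positivity))
  have hb : Metric.closedBall c R ⊆ P.region :=
    (Metric.closedBall_subset_closedBall (min_le_right _ _)).trans hc
  have hr1 : ∀ m, P.r m x ≤ 1 := fun m => hle hx' (MV.v_mem P m)
  have hL1 : ∀ i j, dist (P.v i) (P.v j) ≤ 1 := fun i j => hle (MV.v_mem P i) (MV.v_mem P j)
  obtain ⟨q, ρ, hG⟩ := MV.geometric P hO hx hinj hd hd1 (fun i j h => h2 i j h) hr1 hL1 hR0 hR1 hb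
    (fun m => hle hcm (MV.v_mem P m)) (hle hcm hx')
  have hK1 : 1 ≤ K := by
    rw [hK, le_div_iff₀ (by positivity)]
    have e1 : dstar ^ 6 ≤ 1 := pow_le_one₀ hd.le hd1
    have e2 : R ^ 2 ≤ 1 := pow_le_one₀ hR0.le hR1
    have : dstar ^ 6 * R ^ 2 ≤ 1 * 1 := by gcongr
    linarith
  have hKδ : dstar ^ 6 * R ^ 2 / 256 = 1 / K := by rw [hK, one_div_div]
  rw [hKδ] at hG
  obtain ⟨l', hl, hln⟩ := MV.lambda_bound P hO hx hr1 hL1 hK1 hG i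
  refine ⟨hl.differentiableAt, ?_⟩
  have : ‖gradient (P.lambda i) x‖ = ‖l'‖ := by
    unfold gradient
    rw [LinearIsometryEquiv.norm_map, hl.fderiv]
  rw [this]
  refine hln.trans ?_
  have := MV.n_bound P hd (fun i j h => h2 i j h) hL1
  gcongr
end
end
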